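/- arXiv:2110.13906 — 4 statements merged into one kernel-verified Lean document; each statement's English description precedes it below -/
import Mathlib

section
/- For every n ≥ 1, the sum over all minimal factorizations f = ((a_1 b_1),…,(a_n b_n)) ∈ F_n of the product ∏_{i=1}^n 1/(b_i − a_i) equals n!. -/
/-- A rooted forest on vertex set `V`, encoded by its parent function:
`parent v = some u` means `u` is the parent of `v` (edges are directed away from
the roots, so `(u,v)` is an edge), and `parent v = none` means `v` is a root.
Acyclicity guarantees that every connected component is a tree with a
distinguished root. -/
structure RootedForest (V : Type) where
  parent : V → Option V
  acyclic : ∀ v : V, ¬ Relation.TransGen (fun a b : V => parent a = some b) v v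

namespace RootedForest

variable {V : Type} [Fintype V] [LinearOrder V]

/-- `F.Desc u v` means `v` is a (strict) descendant of `u`. -/
def Desc (F : RootedForest V) (u v : V) : Prop :=
  Relation.TransGen (fun a b : V => F.parent a = some b) v u

/-- The hook of `u`: `u` together with all of its descendants. -/
def hook (F : RootedForest V) (u : V) : Set V := {v : V | v = u ∨ F.Desc u v}

/-- The hook length `h(u)`. -/
noncomputable def h (F : RootedForest V) (u : V) : ℕ := (F.hook u).ncard

/-- The left hook length `h_L(u)`: sum of hook lengths of children smaller than `u`. -/
noncomputable def hL (F : RootedForest V) (u : V) : ℕ :=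
  ∑ v ∈ Finset.univ.filter (fun v : V => F.parent v = some u ∧ v < u), F.h v

/-- The right hook length `h_R(u)`: sum of hook lengths of children larger than `u`. -/
noncomputable def hR (F : RootedForest V) (u : V) : ℕ :=
  ∑ v ∈ Finset.univ.filter (fun v : V => F.parent v = some u ∧ u < v), F.h v

/-- The major index of a rooted forest. -/
noncomputable def maj (F : RootedForest V) : ℕ := ∑ u : V, F.hL u

/-- The comajor index of a rooted forest. -/
noncomputable def comaj (F : RootedForest V) : ℕ := ∑ u : V, F.hR u

/-- The number of inversions: pairs `(u,v)` with `v` a descendant of `u` and `v < u`. -/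
noncomputable def inv (F : RootedForest V) : ℕ :=
  {p : V × V | F.Desc p.1 p.2 ∧ p.2 < p.1}.ncard

/-- The number of coinversions: pairs `(u,v)` with `v` a descendant of `u` and `v > u`. -/
noncomputable def coinv (F : RootedForest V) : ℕ :=
  {p : V × V | F.Desc p.1 p.2 ∧ p.1 < p.2}.ncard

/-- The number of connected components (= number of roots). -/
def comps (F : RootedForest V) : ℕ :=
  (Finset.univ.filter (fun v : V => F.parent v = none)).card

end RootedForest

/-- A `k`-forest on vertex set `Fin n` (vertices `1,…,n`): a rooted forest together with a
colour in `{0,…,k-1}` on each edge.  The colour of the edge `(parent v, v)` is recorded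
at the vertex `v`; roots carry the dummy colour `0`. -/
structure KForest (n k : ℕ) extends RootedForest (Fin n) where
  colour : Fin n → ℕ
  colour_lt : ∀ v, colour v < k
  colour_root : ∀ v, parent v = none → colour v = 0

namespace KForest

variable {n k : ℕ}

/-- The chromatic depth `chr_k(F) = ∑_{(u,v) ∈ E(F)} κ(u,v)·h(v)`. -/
noncomputable def chr (F : KForest n k) : ℕ :=
  ∑ v ∈ Finset.univ.filter (fun v : Fin n => F.parent v ≠ none),
    F.colour v * F.toRootedForest.h v

/-- The chromatic codepth `cochr_k(F) = ∑_{(u,v) ∈ E(F)} (k-1-κ(u,v))·h(v)`. -/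
noncomputable def cochr (F : KForest n k) : ℕ :=
  ∑ v ∈ Finset.univ.filter (fun v : Fin n => F.parent v ≠ none),
    (k - 1 - F.colour v) * F.toRootedForest.h v

/-- `maj_k = maj + chr_k`. -/
noncomputable def majk (F : KForest n k) : ℕ := F.toRootedForest.maj + F.chr

/-- `comaj_k = comaj + cochr_k`. -/
noncomputable def comajk (F : KForest n k) : ℕ := F.toRootedForest.comaj + F.cochr

/-- `inv_k = inv + chr_k`. -/
noncomputable def invk (F : KForest n k) : ℕ := F.toRootedForest.inv + F.chr

/-- `coinv_k = coinv + cochr_k`. -/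
noncomputable def coinvk (F : KForest n k) : ℕ := F.toRootedForest.coinv + F.cochr

end KForest

/-- A minimal factorization of the long cycle `(0 1 ⋯ n)` on `{0,1,…,n}` into `n`
transpositions `(aᵢ bᵢ)` with `aᵢ < bᵢ`, multiplied left to right (the leftmost factor
is applied first, which corresponds to the reversed product in Mathlib's convention). -/
structure MinFact (n : ℕ) where
  a : Fin n → Fin (n+1)
  b : Fin n → Fin (n+1)
  ab_lt : ∀ i, a i < b i
  prod_eq : (List.ofFn (fun i => Equiv.swap (a i) (b i))).reverse.prod = finRotate (n+1)

namespace MinFact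

variable {n : ℕ}

/-- `area(f) = C(n,2) - ∑ aᵢ`. -/
def area (f : MinFact n) : ℤ := (n.choose 2 : ℤ) - ∑ i : Fin n, ((f.a i : ℕ) : ℤ)

/-- `coarea(f) = ∑ (bᵢ - 1) - C(n,2)`. -/
def coarea (f : MinFact n) : ℤ :=
  (∑ i : Fin n, (((f.b i : ℕ) : ℤ) - 1)) - (n.choose 2 : ℤ)

end MinFact

/-- A minimal `k`-factorization of the long cycle `(0 1 ⋯ kn)` on `{0,1,…,kn}` into `n`
cycles of length `k+1`: the `j`-th factor is the cycle `(a j 0, a j 1, …, a j k)`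
(sending `a j 0 ↦ a j 1 ↦ ⋯ ↦ a j k ↦ a j 0`), presented with its least element first,
and the factors are multiplied left to right (leftmost applied first). -/
structure MinKFact (n k : ℕ) where
  a : Fin n → Fin (k+1) → Fin (k*n+1)
  inj : ∀ j, Function.Injective (a j)
  min_first : ∀ j i, a j 0 ≤ a j i
  prod_eq :
    (List.ofFn (fun j => (List.ofFn (a j)).formPerm)).reverse.prod = finRotate (k*n+1)

namespace MinKFact

variable {n k : ℕ}

/-- `area_k(f) = C(kn,2) - n·C(k,2) - k·∑_j a_j^0`. -/
def areak (f : MinKFact n k) : ℤ :=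
  ((k*n).choose 2 : ℤ) - n * (k.choose 2 : ℤ) - k * ∑ j : Fin n, ((f.a j 0 : ℕ) : ℤ)

/-- `coarea_k(f) = k·∑_j (a_j^k - 1) - C(kn,2) - n·C(k,2)`. -/
def coareak (f : MinKFact n k) : ℤ :=
  k * (∑ j : Fin n, (((f.a j (Fin.last k) : ℕ) : ℤ) - 1))
    - ((k*n).choose 2 : ℤ) - n * (k.choose 2 : ℤ)

/-- `semiarea_k(f) = C(kn,2) - ∑_{i=0}^{k-1} ∑_j a_j^i`. -/
def semiareak (f : MinKFact n k) : ℤ :=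
  ((k*n).choose 2 : ℤ) - ∑ i : Fin k, ∑ j : Fin n, ((f.a j i.castSucc : ℕ) : ℤ)

/-- `cosemiarea_k(f) = ∑_{i=1}^{k} ∑_j (a_j^i - 1) - C(kn,2)`. -/
def cosemiareak (f : MinKFact n k) : ℤ :=
  (∑ i : Fin k, ∑ j : Fin n, (((f.a j i.succ : ℕ) : ℤ) - 1)) - ((k*n).choose 2 : ℤ)

end MinKFact

/-- `p` is a `k`-parking function: its nondecreasing rearrangement `b = p ∘ sort p`
satisfies `b i ≤ k * i` (with 0-indexed `i`, matching `bᵢ ≤ k(i-1)` for 1-indexed `i`). -/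
def IsParkingFunction (k : ℕ) {n : ℕ} (p : Fin n → ℕ) : Prop :=
  ∀ i : Fin n, p (Tuple.sort p i) ≤ k * i

/-- The displacement `disp_k(p) = k·C(n,2) - ∑ᵢ aᵢ` of a `k`-parking function. -/
def dispk (k : ℕ) {n : ℕ} (p : Fin n → ℕ) : ℤ :=
  k * (n.choose 2 : ℤ) - ∑ i : Fin n, (p i : ℤ)

instance (n : ℕ) : Finite (MinFact n) :=
  Finite.of_injective (fun f => (f.a, f.b)) (by
    rintro ⟨a, b, _, _⟩ ⟨a', b', _, _⟩ h
    simp only [Prod.mk.injEq] at h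
    obtain ⟨h1, h2⟩ := h
    subst h1
    subst h2
    rfl)

noncomputable instance (n : ℕ) : Fintype (MinFact n) := Fintype.ofFinite _

namespace MFSum

open Equiv Finset

variable {N : ℕ}

/-- Weighted number of factorizations of `p` into `k` transpositions. -/
noncomputable def W : ℕ → Perm (Fin N) → ℚ
  | 0, p => if p = 1 then 1 else 0
  | k+1, p => ∑ a : Fin N, ∑ b : Fin N, if a < b then
      (1 / (((b : ℕ) : ℚ) - ((a : ℕ) : ℚ))) * W k (p * swap a b) else 0

/-- All cycles of `p` are increasing, with classes given by `c`. -/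
structure Good (p : Perm (Fin N)) (c : Fin N → ℕ) : Prop where
  inv : ∀ x, c (p x) = c x
  up : ∀ a b, c a = c b → a < b → a < p a ∧ p a ≤ b
  down : ∀ a b, c a = c b → a < b → b < p b ∨ p b ≤ a

/-- Number of excedances. -/
def exc (p : Perm (Fin N)) : ℕ := (univ.filter (fun x => x < p x)).card

/-- Local weight. -/
noncomputable def e (p : Perm (Fin N)) (x : Fin N) : ℚ :=
  if x < p x then 1 / (((p x : ℕ) : ℚ) - ((x : ℕ) : ℚ)) else 1

/-- Product of local weights. -/
noncomputable def E (p : Perm (Fin N)) : ℚ := ∏ x, e p x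

lemma W_ne_zero (k : ℕ) : ∀ (p : Perm (Fin N)), W k p ≠ 0 →
    ∃ s : Fin k → Fin N × Fin N, ∀ f : Fin N → ℚ,
      (∀ i, f (s i).1 = f (s i).2) → ∀ x, f (p x) = f x := by
  induction k with
  | zero =>
    intro p h
    refine ⟨Fin.elim0, fun f _ x => ?_⟩
    simp only [W] at h
    split_ifs at h with h1
    · simp [h1]
    · exact absurd rfl h
  | succ k ih =>
    intro p h
    simp only [W] at h
    obtain ⟨a, -, h⟩ := Finset.exists_ne_zero_of_sum_ne_zero h
    obtain ⟨b, -, h⟩ := Finset.exists_ne_zero_of_sum_ne_zero h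
    split_ifs at h with hab
    · obtain ⟨s, hs⟩ := ih _ (right_ne_zero_of_mul h)
      refine ⟨Fin.cons (a, b) s, fun f hf x => ?_⟩
      have h0 : f a = f b := by simpa using hf 0
      have h1 := hs f (fun i => by simpa using hf i.succ) (swap a b x)
      simp only [Perm.mul_apply, swap_apply_self] at h1
      rw [h1, swap_apply_def]
      split_ifs with h2 h3
      · rw [h2, h0]
      · rw [h3, h0]
      · rfl
    · exact absurd rfl h

lemma W_merge (p : Perm (Fin N)) (c : Fin N → ℕ) (hc : ∀ x, c (p x) = c x) (a b : Fin N)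
    (hab : c a ≠ c b) (k : ℕ) (hk : k < exc p) : W k (p * swap a b) = 0 := by
  by_contra hW
  obtain ⟨s, hs⟩ := W_ne_zero k _ hW
  have hne : a ≠ b := fun h => hab (by rw [h])
  have key : ∀ f : Fin N → ℚ, (∀ i, f (s i).1 = f (s i).2) → ∀ x, f (p x) = f x := by
    intro f hf
    have h := hs f hf
    simp only [Perm.mul_apply] at h
    have ha := h a
    have hb := h b
    rw [swap_apply_left] at ha
    rw [swap_apply_right] at hb
    have hx : ∀ x, x ≠ a → x ≠ b → f (p x) = f x := fun x h1 h2 => by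
      have := h x
      rwa [swap_apply_of_ne_of_ne h1 h2] at this
    have hsum : ∑ x ∈ univ.filter (fun x => c x = c a), f (p x)
        = ∑ x ∈ univ.filter (fun x => c x = c a), f x := by
      refine Finset.sum_equiv p ?_ ?_
      · intro i; simp [hc]
      · intro i _; rfl
    have hmem : a ∈ univ.filter (fun x => c x = c a) := by simp
    rw [← Finset.add_sum_erase _ _ hmem, ← Finset.add_sum_erase _ f hmem] at hsum
    have h2 : ∑ x ∈ (univ.filter (fun x => c x = c a)).erase a, f (p x)
        = ∑ x ∈ (univ.filter (fun x => c x = c a)).erase a, f x := by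
      refine Finset.sum_congr rfl fun x hxm => ?_
      simp only [mem_erase, mem_filter, mem_univ, true_and] at hxm
      exact hx x hxm.1 (fun h => hab (by rw [← hxm.2, h]))
    rw [h2] at hsum
    have h3 : f (p a) = f a := add_right_cancel hsum
    intro x
    by_cases h1 : x = a
    · rw [h1, h3]
    · by_cases h2 : x = b
      · rw [h2, ha, ← hb, h3]
      · exact hx x h1 h2
  let L : (Fin N → ℚ) →ₗ[ℚ] ((Fin k → ℚ) × ({x : Fin N // ¬ x < p x} → ℚ)) :=
    { toFun := fun f => (fun i => f (s i).1 - f (s i).2, fun x => f x)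
      map_add' := by
        intro f g
        ext i
        · simp; ring
        · simp
      map_smul' := by
        intro r f
        ext i
        · simp; ring
        · simp }
  have hL : Function.Injective L := by
    rw [← LinearMap.ker_eq_bot, LinearMap.ker_eq_bot']
    intro f hf
    have h1 : ∀ i, f (s i).1 = f (s i).2 := fun i => by
      have := congrFun (congrArg Prod.fst hf) i
      exact sub_eq_zero.mp this
    have h2 : ∀ x, ¬ x < p x → f x = 0 := fun x hx =>
      congrFun (congrArg Prod.snd hf) ⟨x, hx⟩
    have h3 := key f h1
    have : ∀ m : ℕ, ∀ x : Fin N, N - x.val ≤ m → f x = 0 := by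
      intro m
      induction m with
      | zero => intro x hx; have := x.2; omega
      | succ m ih =>
        intro x hx
        by_cases h : x < p x
        · rw [← h3 x]
          apply ih
          have := (p x).2
          have h' : x.val < (p x).val := h
          omega
        · exact h2 x h
    funext x
    exact this _ x le_rfl
  have := LinearMap.finrank_le_finrank_of_injective hL
  rw [Module.finrank_prod] at this
  simp only [Module.finrank_fintype_fun_eq_card, Fintype.card_fin] at this
  rw [Fintype.card_subtype_compl, Fintype.card_fin, Fintype.card_subtype] at this
  have h4 : exc p ≤ N := by
    simpa [exc] using Finset.card_le_univ (univ.filter (fun x => x < p x))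
  unfold exc at *
  omega

lemma Good.split {p : Perm (Fin N)} {c : Fin N → ℕ} (h : Good p c) {a b : Fin N}
    (hab : a < b) (hc : c a = c b) :
    Good (p * swap a b) (fun x => if c x = c a ∧ a < x ∧ x ≤ b then 2 * c x + 1 else 2 * c x) := by
  obtain ⟨h1, h2, h3⟩ := h
  have ua := h2 a b hc hab
  have da := h3 a b hc hab
  refine ⟨?_, ?_, ?_⟩
  · intro x
    simp only [Perm.mul_apply, swap_apply_def]
    have := h1 x
    have := h1 a
    have := h1 b
    have := h2 x a
    have := h2 x b
    have := h3 a x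
    have := h2 a x
    split_ifs <;> grind
  · intro x y hxy hlt
    simp only [Perm.mul_apply, swap_apply_def] at *
    have := h2 x y
    have := h2 x a
    have := h2 x b
    have := h2 b y
    grind
  · intro x y hxy hlt
    simp only [Perm.mul_apply, swap_apply_def] at *
    have := h3 x y
    have := h3 x b
    have := h2 a x
    have := h3 a y
    grind

lemma split_facts {p : Perm (Fin N)} {c : Fin N → ℕ} (h : Good p c) {a b : Fin N}
    (hab : a < b) (hc : c a = c b) :
    exc p = exc (p * swap a b) + 1 ∧
    (1 / (((b : ℕ) : ℚ) - ((a : ℕ) : ℚ))) * E (p * swap a b)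
      = E p * (((p a : ℕ) : ℚ) - ((a : ℕ) : ℚ)) *
        (1 / (((b : ℕ) : ℚ) - ((a : ℕ) : ℚ)) -
          if b < p b then 1 / (((p b : ℕ) : ℚ) - ((a : ℕ) : ℚ)) else 0) := by
  have ua := h.up a b hc hab
  have da := h.down a b hc hab
  have hne : b ≠ a := hab.ne'
  have hmem : b ∈ (univ : Finset (Fin N)).erase a := by simp [hne]
  have hrest : ∀ x ∈ ((univ : Finset (Fin N)).erase a).erase b, (p * swap a b) x = p x := by
    intro x hx
    simp only [mem_erase, mem_univ, and_true] at hx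
    rw [Perm.mul_apply, swap_apply_of_ne_of_ne hx.2 hx.1]
  have hpa : (p * swap a b) a = p b := by simp
  have hpb : (p * swap a b) b = p a := by simp
  have hnb : ¬ b < p a := not_lt.mpr ua.2
  have hiff : a < p b ↔ b < p b := ⟨fun h => da.resolve_right (not_le.mpr h), fun h => hab.trans h⟩
  constructor
  · unfold exc
    rw [Finset.card_filter, Finset.card_filter]
    rw [← Finset.add_sum_erase _ _ (mem_univ a), ← Finset.add_sum_erase _ _ hmem]
    rw [← Finset.add_sum_erase univ (fun x => if x < (p * swap a b) x then 1 else 0) (mem_univ a),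
      ← Finset.add_sum_erase _ (fun x => if x < (p * swap a b) x then 1 else 0) hmem]
    rw [Finset.sum_congr rfl (fun x hx => by rw [hrest x hx] :
      ∀ x ∈ ((univ : Finset (Fin N)).erase a).erase b,
        (if x < (p * swap a b) x then 1 else 0) = if x < p x then 1 else 0)]
    rw [hpa, hpb, if_pos ua.1, if_neg hnb]
    simp only [hiff]
    omega
  · unfold E
    rw [← Finset.mul_prod_erase _ _ (mem_univ a), ← Finset.mul_prod_erase _ _ hmem]
    rw [← Finset.mul_prod_erase univ (e p) (mem_univ a), ← Finset.mul_prod_erase _ (e p) hmem]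
    rw [Finset.prod_congr rfl (fun x hx => by unfold e; rw [hrest x hx] :
      ∀ x ∈ ((univ : Finset (Fin N)).erase a).erase b, e (p * swap a b) x = e p x)]
    generalize ∏ x ∈ ((univ : Finset (Fin N)).erase a).erase b, e p x = R
    unfold e
    rw [hpa, hpb, if_pos ua.1, if_neg hnb]
    simp only [hiff]
    have n1 : (((p a : ℕ) : ℚ) - ((a : ℕ) : ℚ)) ≠ 0 := by
      have : ((a : ℕ) : ℚ) < ((p a : ℕ) : ℚ) := by exact_mod_cast ua.1
      linarith
    have n2 : (((b : ℕ) : ℚ) - ((a : ℕ) : ℚ)) ≠ 0 := by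
      have : ((a : ℕ) : ℚ) < ((b : ℕ) : ℚ) := by exact_mod_cast hab
      linarith
    split_ifs with hb
    · have n3 : (((p b : ℕ) : ℚ) - ((b : ℕ) : ℚ)) ≠ 0 := by
        have : ((b : ℕ) : ℚ) < ((p b : ℕ) : ℚ) := by exact_mod_cast hb
        linarith
      have n4 : (((p b : ℕ) : ℚ) - ((a : ℕ) : ℚ)) ≠ 0 := by
        have : ((a : ℕ) : ℚ) < ((p b : ℕ) : ℚ) := by exact_mod_cast hab.trans hb
        linarith
      field_simp
      ring
    · field_simp
      ring

lemma telescope {p : Perm (Fin N)} {c : Fin N → ℕ} (h : Good p c) (a : Fin N) (g : Fin N → ℚ) :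
    (∑ b ∈ univ.filter (fun b => a < b ∧ c a = c b), (g b - if b < p b then g (p b) else 0))
      = if a < p a then g (p a) else 0 := by
  rw [Finset.sum_sub_distrib, ← Finset.sum_filter]
  by_cases ha : a < p a
  · rw [if_pos ha]
    have hm : p a ∈ univ.filter (fun b => a < b ∧ c a = c b) := by simp [ha, h.inv]
    rw [← Finset.add_sum_erase _ _ hm, add_sub_assoc, add_eq_left, sub_eq_zero]
    symm
    refine Finset.sum_equiv p ?_ ?_
    · intro b
      simp only [mem_filter, mem_univ, true_and, mem_erase, h.inv, ne_eq,
        EmbeddingLike.apply_eq_iff_eq]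
      constructor
      · rintro ⟨⟨h1, h2⟩, h3⟩
        exact ⟨h1.ne', h1.trans h3, h2⟩
      · rintro ⟨h1, h2, h3⟩
        rcases lt_or_gt_of_ne h1 with h4 | h4
        · exact absurd (h.up b a h3.symm h4).2 (not_le.mpr h2)
        · exact ⟨⟨h4, h3⟩, (h.down a b h3 h4).resolve_right (not_le.mpr h2)⟩
    · intro i _; rfl
  · rw [if_neg ha]
    have : univ.filter (fun b => a < b ∧ c a = c b) = ∅ := by
      rw [Finset.filter_eq_empty_iff]
      rintro b - ⟨h1, h2⟩
      exact ha (h.up a b h2 h1).1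
    simp [this]

lemma main (k : ℕ) : ∀ (p : Perm (Fin N)) (c : Fin N → ℕ), Good p c → exc p = k →
    W k p = (k.factorial : ℚ) * E p := by
  induction k with
  | zero =>
    intro p c h hk
    have hx : ∀ x, ¬ x < p x := by
      simpa [exc, Finset.filter_eq_empty_iff] using hk
    have hp : p = 1 := by
      ext x
      rcases lt_trichotomy x (p x) with h1 | h1 | h1
      · exact absurd h1 (hx x)
      · simp [← h1]
      · exact absurd (h.up (p x) x (h.inv x) h1).1 (hx _)
    subst hp
    simp [W, E, e]
  | succ k ih =>
    intro p c h hk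
    have h1 : ∀ a b : Fin N, (if a < b then
        (1 / (((b : ℕ) : ℚ) - ((a : ℕ) : ℚ))) * W k (p * swap a b) else 0)
        = if (a < b ∧ c a = c b) then (k.factorial : ℚ) *
          (E p * (((p a : ℕ) : ℚ) - ((a : ℕ) : ℚ)) *
        (1 / (((b : ℕ) : ℚ) - ((a : ℕ) : ℚ)) -
          if b < p b then 1 / (((p b : ℕ) : ℚ) - ((a : ℕ) : ℚ)) else 0)) else 0 := by
      intro a b
      by_cases hab : a < b
      · by_cases hc : c a = c b
        · rw [if_pos hab, if_pos ⟨hab, hc⟩]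
          obtain ⟨f1, f2⟩ := split_facts h hab hc
          rw [ih _ _ (h.split hab hc) (by omega), ← f2]
          ring
        · rw [if_pos hab, if_neg (fun h => hc h.2), W_merge p c h.inv a b hc k (by omega), mul_zero]
      · rw [if_neg hab, if_neg (fun h => hab h.1)]
    have h2 : ∀ a : Fin N, (∑ b : Fin N, if a < b then
        (1 / (((b : ℕ) : ℚ) - ((a : ℕ) : ℚ))) * W k (p * swap a b) else 0)
        = (k.factorial : ℚ) * E p * if a < p a then 1 else 0 := by
      intro a
      rw [Finset.sum_congr rfl (fun b _ => h1 a b), ← Finset.sum_filter, ← Finset.mul_sum,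
        ← Finset.mul_sum,
        telescope h a (fun b => 1 / (((b : ℕ) : ℚ) - ((a : ℕ) : ℚ)))]
      split_ifs with ha
      · have n1 : (((p a : ℕ) : ℚ) - ((a : ℕ) : ℚ)) ≠ 0 := by
          have : ((a : ℕ) : ℚ) < ((p a : ℕ) : ℚ) := by exact_mod_cast ha
          linarith
        field_simp
      · simp
    simp only [W]
    rw [Finset.sum_congr rfl (fun a _ => h2 a), ← Finset.mul_sum, Finset.sum_boole]
    unfold exc at hk
    rw [hk, Nat.factorial_succ]
    push_cast
    ring

lemma W_eq_sum (k : ℕ) : ∀ p : Perm (Fin N), W k p =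
    ∑ s : Fin k → Fin N × Fin N,
      if (∀ i, (s i).1 < (s i).2) ∧
        (List.ofFn (fun i => swap (s i).1 (s i).2)).reverse.prod = p
      then ∏ i, (1 : ℚ) / ((((s i).2 : ℕ) : ℚ) - (((s i).1 : ℕ) : ℚ)) else 0 := by
  induction k with
  | zero => intro p; simp [W, eq_comm]
  | succ k ih =>
    intro p
    simp only [W]
    rw [← (Fin.consEquiv (fun _ => Fin N × Fin N)).sum_comp, Fintype.sum_prod_type,
      Fintype.sum_prod_type]
    refine Finset.sum_congr rfl fun a _ => Finset.sum_congr rfl fun b _ => ?_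
    by_cases hab : a < b
    · rw [if_pos hab, ih, Finset.mul_sum]
      refine Finset.sum_congr rfl fun s _ => ?_
      have hiff : (List.ofFn (fun i => swap (s i).1 (s i).2)).reverse.prod * swap a b = p ↔
          (List.ofFn (fun i => swap (s i).1 (s i).2)).reverse.prod = p * swap a b := by
        rw [← eq_mul_inv_iff_mul_eq, swap_inv]
      simp [Fin.consEquiv, List.ofFn_succ, Fin.forall_fin_succ, hab, hiff, Fin.prod_univ_succ, mul_comm]
    · rw [if_neg hab]
      symm
      refine Finset.sum_eq_zero fun s _ => if_neg ?_
      rintro ⟨h, -⟩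
      exact hab (by simpa [Fin.consEquiv] using h 0)

lemma good_rot (n : ℕ) : Good (finRotate (n+1)) (fun _ => 0) := by
  refine ⟨fun _ => rfl, fun a b _ hab => ?_, fun a b _ hab => ?_⟩
  · have : a.val < n := by have := b.2; have : a.val < b.val := hab; omega
    have := coe_finRotate_of_ne_last (i := a) (by intro h; simp [h] at this)
    constructor
    · rw [Fin.lt_def]; omega
    · rw [Fin.le_def]; have : a.val < b.val := hab; omega
  · by_cases hb : b = Fin.last n
    · right; rw [hb, finRotate_last]; exact Fin.zero_le _
    · left; have := coe_finRotate_of_ne_last hb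
      rw [Fin.lt_def]; omega

lemma exc_rot (n : ℕ) : exc (finRotate (n+1)) = n := by
  unfold exc
  have : univ.filter (fun x => x < finRotate (n+1) x) = univ.erase (Fin.last n) := by
    ext x
    simp only [mem_filter, mem_univ, true_and, mem_erase, and_true]
    by_cases hb : x = Fin.last n
    · simp [hb]
    · have := coe_finRotate_of_ne_last hb
      simp only [hb, ne_eq, not_false_eq_true, iff_true]
      rw [Fin.lt_def]; omega
  rw [this, Finset.card_erase_of_mem (mem_univ _)]
  simp

lemma E_rot (n : ℕ) : E (finRotate (n+1)) = 1 := by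
  unfold E
  refine Finset.prod_eq_one fun x _ => ?_
  unfold e
  by_cases hb : x = Fin.last n
  · simp [hb]
  · rw [coe_finRotate_of_ne_last hb]
    simp

end MFSum

/-- For every `n ≥ 1`,
`∑_{f ∈ F_n} ∏_{i=1}^n 1/(b_i - a_i) = n!`. -/
theorem stmt4 (n : ℕ) (hn : 1 ≤ n) :
    ∑ f : MinFact n, ∏ i : Fin n,
        (1 : ℚ) / (((f.b i : ℕ) : ℚ) - ((f.a i : ℕ) : ℚ))
      = (n.factorial : ℚ) := by
  have hW := MFSum.main n (finRotate (n+1)) (fun _ => 0) (MFSum.good_rot n) (MFSum.exc_rot n)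
  rw [MFSum.E_rot, mul_one, MFSum.W_eq_sum, ← Finset.sum_filter] at hW
  rw [← hW]
  refine Finset.sum_bij (fun f _ i => (f.a i, f.b i)) ?_ ?_ ?_ ?_
  · intro f _
    simp only [Finset.mem_filter, Finset.mem_univ, true_and]
    exact ⟨f.ab_lt, f.prod_eq⟩
  · rintro ⟨a, b, h1, h2⟩ _ ⟨a', b', h1', h2'⟩ _ h
    have ha : a = a' := funext fun i => congrArg Prod.fst (congrFun h i)
    have hb : b = b' := funext fun i => congrArg Prod.snd (congrFun h i)
    subst ha
    subst hb
    rfl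
  · intro s hs
    simp only [Finset.mem_filter, Finset.mem_univ, true_and] at hs
    exact ⟨⟨fun i => (s i).1, fun i => (s i).2, hs.1, hs.2⟩, Finset.mem_univ _, rfl⟩
  · intro f _
    rfl
end

section
/- For all n, k ≥ 1, there exists a bijection β: R_n^k → P_n^k such that disp_k(β(F)) = inv_k(F) for all F ∈ R_n^k; consequently ∑_{p ∈ P_n^k} q^{disp_k(p)} = ∑_{F ∈ R_n^k} q^{inv_k(F)}. -/
section Material
open Finset

/-! ### Algebra -/
def brk (q : ℚ) (N : ℕ) : ℚ := ∑ j ∈ range N, q ^ j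

lemma brk_mul (q : ℚ) (N : ℕ) : (1 - q) * brk q N = 1 - q ^ N := mul_neg_geom_sum q N

lemma brk_comp (q : ℚ) (hq : q ≠ 1) (a s : ℕ) :
    brk q a * ∑ j ∈ range s, q ^ (j * a) = brk q (s * a) := by
  have h : (1 - q) ≠ 0 := sub_ne_zero.mpr (Ne.symm hq)
  apply mul_left_cancel₀ h
  rw [← mul_assoc, brk_mul, brk_mul]
  have := mul_neg_geom_sum (q ^ a) s
  rw [← pow_mul, mul_comm a s] at this
  rw [← this]
  congr 1
  apply Finset.sum_congr rfl
  intro j _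
  rw [← pow_mul, mul_comm]

noncomputable def egf (f : ℕ → ℚ) : PowerSeries ℚ := PowerSeries.mk fun n => f n / (n.factorial : ℚ)

lemma egf_inj {f g : ℕ → ℚ} (h : egf f = egf g) : f = g := by
  funext n
  have := congrArg (PowerSeries.coeff n) h
  simp only [egf, PowerSeries.coeff_mk] at this
  have h0 : (n.factorial : ℚ) ≠ 0 := by positivity
  field_simp at this
  exact this

lemma egf_deriv (f : ℕ → ℚ) : PowerSeries.derivative ℚ (egf f) = egf (fun n => f (n + 1)) := by
  ext n
  simp only [egf, PowerSeries.coeff_mk, PowerSeries.coeff_derivative]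
  rw [Nat.factorial_succ]
  push_cast
  field_simp

lemma egf_mul (f g : ℕ → ℚ) : egf f * egf g =
    egf (fun n => ∑ p ∈ HasAntidiagonal.antidiagonal n, (n.choose p.1 : ℚ) * (f p.1 * g p.2)) := by
  ext n
  simp only [egf, PowerSeries.coeff_mk, PowerSeries.coeff_mul]
  rw [Finset.sum_div]
  apply Finset.sum_congr rfl
  rintro ⟨a, b⟩ hp
  rw [HasAntidiagonal.mem_antidiagonal] at hp
  simp only at hp ⊢
  subst hp
  rw [Nat.choose_symm_add, Nat.add_choose, Nat.cast_div (Nat.factorial_mul_factorial_dvd_factorial_add a b) (by positivity)]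
  push_cast
  field_simp

lemma egf_rescale (c : ℚ) (f : ℕ → ℚ) :
    PowerSeries.rescale c (egf f) = egf (fun n => c ^ n * f n) := by
  ext n
  simp [egf, PowerSeries.coeff_rescale, mul_div_assoc]

lemma ode_unique (U G H : PowerSeries ℚ) (c : ℚ) (hc : c ≠ 0)
    (hG : PowerSeries.C c * PowerSeries.derivative ℚ G = G * U)
    (hH : PowerSeries.C c * PowerSeries.derivative ℚ H = H * U)
    (h0 : PowerSeries.coeff 0 G = PowerSeries.coeff 0 H) : G = H := by
  ext n
  induction n using Nat.strong_induction_on with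
  | _ n ih =>
    cases n with
    | zero => exact h0
    | succ n =>
      have h1 := congrArg (PowerSeries.coeff n) hG
      have h2 := congrArg (PowerSeries.coeff n) hH
      rw [PowerSeries.coeff_C_mul, PowerSeries.coeff_derivative,
        PowerSeries.coeff_mul] at h1 h2
      have h3 : c * (PowerSeries.coeff (n+1) G * ((n : ℚ) + 1))
          = c * (PowerSeries.coeff (n+1) H * ((n : ℚ) + 1)) := by
        rw [h1, h2]
        apply Finset.sum_congr rfl
        intro p hp
        rw [ih p.1 (by have := HasAntidiagonal.mem_antidiagonal.mp hp; omega)]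
      have h4 := mul_left_cancel₀ hc h3
      exact mul_right_cancel₀ (by positivity) h4

lemma deriv_rescale (c : ℚ) (f : PowerSeries ℚ) :
    PowerSeries.derivative ℚ (PowerSeries.rescale c f)
      = PowerSeries.C c * PowerSeries.rescale c (PowerSeries.derivative ℚ f) := by
  ext n
  simp only [PowerSeries.coeff_derivative, PowerSeries.coeff_rescale,
    PowerSeries.coeff_C_mul]
  ring

/-- A family satisfying the forest recursion satisfies the parking recursion. -/
lemma forest_to_parking (q : ℚ) (hq : q ≠ 1) (k : ℕ) (f : ℕ → ℕ → ℚ) (h0 : ∀ s, f s 0 = 1)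
    (hf : ∀ s n, f s (n + 1) = ∑ p ∈ HasAntidiagonal.antidiagonal n,
      (n.choose p.1 : ℚ) * ((brk q (s * (p.1 + 1)) * f k p.1) * f s p.2)) (s n : ℕ) :
    f s (n + 1) = ∑ p ∈ HasAntidiagonal.antidiagonal n,
      (n.choose p.1 : ℚ) * ((brk q (k * p.1 + s) * f s p.1) * f k p.2) := by
  have hc : (1 - q) ≠ 0 := sub_ne_zero.mpr (Ne.symm hq)
  set U : ℕ → PowerSeries ℚ := fun s =>
    egf (f k) - PowerSeries.C (q ^ s) * PowerSeries.rescale (q ^ s) (egf (f k)) with hU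
  have key : ∀ s, PowerSeries.C (1 - q) * PowerSeries.derivative ℚ (egf (f s)) = egf (f s) * U s := by
    intro s
    have e1 : U s = PowerSeries.C (1 - q) * egf (fun m => brk q (s * (m + 1)) * f k m) := by
      ext m
      simp only [hU, map_sub (PowerSeries.coeff m), PowerSeries.coeff_C_mul, egf_rescale]
      simp only [egf, PowerSeries.coeff_mk]
      have := brk_mul q (s * (m + 1))
      linear_combination (-(f k m / (m.factorial : ℚ))) * this
    have e2 : PowerSeries.derivative ℚ (egf (f s))
        = egf (fun m => brk q (s * (m + 1)) * f k m) * egf (f s) := by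
      rw [egf_deriv, egf_mul]
      congr 1
      funext n
      exact hf s n
    rw [e1, e2]; ring
  have c0 : ∀ s, PowerSeries.coeff 0 (egf (f s)) = 1 := by
    intro s; simp [egf, h0]
  have add : ∀ s t, egf (f (s + t)) = egf (f s) * PowerSeries.rescale (q ^ s) (egf (f t)) := by
    intro s t
    apply ode_unique (U (s + t)) _ _ (1 - q) hc (key _)
    · have hU' : U (s + t) = U s + PowerSeries.C (q ^ s) * PowerSeries.rescale (q ^ s) (U t) := by
        simp only [hU, map_sub, map_mul, PowerSeries.rescale_rescale]
        rw [show (PowerSeries.rescale (q ^ s)) (PowerSeries.C (q ^ t)) = PowerSeries.C (q ^ t) by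
          ext n; simp only [PowerSeries.coeff_rescale, PowerSeries.coeff_C]; split_ifs with h <;> simp [h]]
        rw [pow_add, map_mul]
        simp only [mul_comm (q ^ t) (q ^ s)]
        ring
      have k2 := congrArg (PowerSeries.rescale (q ^ s)) (key t)
      rw [map_mul, map_mul, show (PowerSeries.rescale (q ^ s)) (PowerSeries.C (1 - q)) = PowerSeries.C (1 - q) by
          ext n; simp only [PowerSeries.coeff_rescale, PowerSeries.coeff_C]; split_ifs with h <;> simp [h]] at k2
      rw [Derivation.leibniz, deriv_rescale, hU', smul_eq_mul, smul_eq_mul]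
      linear_combination (PowerSeries.rescale (q ^ s) (egf (f t))) * key s
        + egf (f s) * PowerSeries.C (q ^ s) * k2
    · rw [c0, PowerSeries.coeff_mul]
      simp [PowerSeries.coeff_rescale, egf, h0]
  have comm : egf (f s) * PowerSeries.rescale (q ^ s) (egf (f k))
      = egf (f k) * PowerSeries.rescale (q ^ k) (egf (f s)) := by
    rw [← add, ← add, add_comm]
  have fin : PowerSeries.C (1 - q) * PowerSeries.derivative ℚ (egf (f s))
      = PowerSeries.C (1 - q) * (egf (fun m => brk q (k * m + s) * f s m) * egf (f k)) := by
    have e1 : PowerSeries.C (1 - q) * egf (fun m => brk q (k * m + s) * f s m)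
        = egf (f s) - PowerSeries.C (q ^ s) * PowerSeries.rescale (q ^ k) (egf (f s)) := by
      ext m
      simp only [map_sub (PowerSeries.coeff m), PowerSeries.coeff_C_mul, egf_rescale]
      simp only [egf, PowerSeries.coeff_mk]
      have := brk_mul q (k * m + s)
      rw [mul_div_assoc', ← mul_assoc (1 - q), this]
      ring
    rw [key, ← mul_assoc, e1]
    simp only [hU]
    linear_combination (-PowerSeries.C (q ^ s)) * comm
  have fin2 := mul_left_cancel₀ (by rw [Ne, map_eq_zero_iff _ PowerSeries.C_injective]; exact hc) fin
  rw [egf_deriv, egf_mul] at fin2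
  exact congrFun (egf_inj fin2) n

lemma two_rec_eq (q : ℚ) (hq : q ≠ 1) (k : ℕ) (f g : ℕ → ℕ → ℚ) (h0 : ∀ s, f s 0 = 1)
    (hg0 : ∀ s, g s 0 = 1)
    (hf : ∀ s n, f s (n + 1) = ∑ p ∈ HasAntidiagonal.antidiagonal n,
      (n.choose p.1 : ℚ) * ((brk q (s * (p.1 + 1)) * f k p.1) * f s p.2))
    (hg : ∀ s n, g s (n + 1) = ∑ p ∈ HasAntidiagonal.antidiagonal n,
      (n.choose p.1 : ℚ) * ((brk q (k * p.1 + s) * g s p.1) * g k p.2)) (n : ℕ) :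
    ∀ s, f s n = g s n := by
  induction n using Nat.strong_induction_on with
  | _ n ih =>
    intro s
    cases n with
    | zero => rw [h0, hg0]
    | succ n =>
      rw [forest_to_parking q hq k f h0 hf, hg]
      apply Finset.sum_congr rfl
      intro p hp
      have := HasAntidiagonal.mem_antidiagonal.mp hp
      rw [ih p.1 (by omega), ih p.2 (by omega)]

/-! ### Generic sums -/
lemma sum_part {ι κ : Type*} (P : Finset ι) (I : Finset κ) (C : κ → ι → Prop)
    [∀ a, DecidablePred (C a)] (w : ι → ℚ)
    (h : ∀ p ∈ P, ∃ a ∈ I, C a p ∧ ∀ b ∈ I, C b p → b = a) :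
    ∑ p ∈ P, w p = ∑ a ∈ I, ∑ p ∈ P.filter (C a), w p := by
  simp only [Finset.sum_filter]
  rw [Finset.sum_comm]
  apply Finset.sum_congr rfl
  intro p hp
  obtain ⟨a, ha, hC, hu⟩ := h p hp
  rw [Finset.sum_eq_single a]
  · simp [hC]
  · intro b hb hne
    rw [if_neg]
    intro hCb
    exact hne (hu b hb hCb)
  · intro h; exact absurd ha h

lemma sum_rank {α : Type*} [LinearOrder α] (q : ℚ) (A : Finset α) :
    ∑ r ∈ A, q ^ (A.filter (· < r)).card = brk q A.card := by
  induction A using Finset.induction_on_max with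
  | empty => simp [brk]
  | insert a s h ih =>
    have ha : a ∉ s := fun h' => lt_irrefl _ (h a h')
    rw [Finset.sum_insert ha, Finset.card_insert_of_notMem ha, brk, Finset.sum_range_succ, add_comm]
    congr 1
    · rw [← brk, ← ih]
      apply Finset.sum_congr rfl
      intro r hr
      rw [Finset.filter_insert, if_neg (not_lt.mpr (h r hr).le)]
    · rw [Finset.filter_insert, if_neg (lt_irrefl a), Finset.filter_true_of_mem h]

lemma exists_equiv_of_gf {A B : Type*} [Fintype A] [Fintype B] (a : A → ℕ) (b : B → ℕ)
    (h : ∀ q : ℚ, q ≠ 0 → q ≠ 1 → ∑ x, q ^ a x = ∑ y, q ^ b y) :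
    ∃ e : A ≃ B, ∀ x, b (e x) = a x := by
  classical
  have hp : (∑ x, (Polynomial.X : Polynomial ℚ) ^ a x) = ∑ y, (Polynomial.X : Polynomial ℚ) ^ b y := by
    apply Polynomial.eq_of_infinite_eval_eq
    apply Set.Infinite.mono (s := ({0, 1} : Set ℚ)ᶜ)
    · intro q hq
      simp only [Set.mem_compl_iff, Set.mem_insert_iff, Set.mem_singleton_iff, not_or] at hq
      simpa [Polynomial.eval_finsetSum] using h q hq.1 hq.2
    · exact Set.Finite.infinite_compl (Set.toFinite _)
  have hc : ∀ d, Fintype.card {x // a x = d} = Fintype.card {y // b y = d} := by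
    intro d
    have := congrArg (fun p => Polynomial.coeff p d) hp
    simp only [Polynomial.finsetSum_coeff, Polynomial.coeff_X_pow] at this
    rw [Fintype.card_subtype, Fintype.card_subtype]
    simp only [Finset.sum_boole] at this
    have h2 : (univ.filter fun x => d = a x).card = (univ.filter fun y => d = b y).card := by
      exact_mod_cast this
    simpa only [eq_comm] using h2
  have e : ∀ d, {x // a x = d} ≃ {y // b y = d} := fun d => Fintype.equivOfCardEq (hc d)
  refine ⟨(Equiv.sigmaFiberEquiv a).symm.trans ((Equiv.sigmaCongrRight e).trans
    (Equiv.sigmaFiberEquiv b)), fun x => ?_⟩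
  simp [Equiv.sigmaFiberEquiv]
  exact (e (a x) ⟨x, rfl⟩).2

open Finset

/-! ### Parking side -/
section Parking
variable {α : Type} [Fintype α] [DecidableEq α]

def IsP (k s : ℕ) (S : Finset α) (p : α → ℕ) : Prop :=
  (∀ x, x ∉ S → p x = 0) ∧ ∀ i < S.card, i < (S.filter (fun x => p x < k * i + s)).card

lemma IsP.bound {k s : ℕ} {S : Finset α} {p : α → ℕ} (h : IsP k s S p) (x : α) :
    p x ≤ k * S.card + s := by
  by_cases hx : x ∈ S
  · have hc : 0 < S.card := Finset.card_pos.mpr ⟨x, hx⟩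
    have h1 := h.2 (S.card - 1) (by omega)
    have h2 : S.filter (fun x => p x < k * (S.card - 1) + s) = S :=
      Finset.eq_of_subset_of_card_le (Finset.filter_subset _ _) (by omega)
    rw [← h2, Finset.mem_filter] at hx
    have h3 : k * (S.card - 1) ≤ k * S.card := Nat.mul_le_mul_left _ (by omega)
    omega
  · rw [h.1 x hx]; omega

lemma IsP.bound_lt {k s : ℕ} {S : Finset α} {p : α → ℕ} (h : IsP k s S p) (x : α) (hx : x ∈ S) :
    p x < k * S.card + s := by
  have hc : 0 < S.card := Finset.card_pos.mpr ⟨x, hx⟩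
  have h1 := h.2 (S.card - 1) (by omega)
  have h2 : S.filter (fun x => p x < k * (S.card - 1) + s) = S :=
    Finset.eq_of_subset_of_card_le (Finset.filter_subset _ _) (by omega)
  rw [← h2, Finset.mem_filter] at hx
  have h3 : k * (S.card - 1) ≤ k * S.card := Nat.mul_le_mul_left _ (by omega)
  omega

lemma finite_IsP (k s : ℕ) (S : Finset α) : {p : α → ℕ | IsP k s S p}.Finite := by
  apply Set.Finite.subset (s := {p : α → ℕ | ∀ x, p x ∈ Set.Iic (k * S.card + s)})
  · exact Set.Finite.pi' fun _ => Set.finite_Iic _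
  · intro p hp x
    exact IsP.bound hp x

noncomputable def PS (k s : ℕ) (S : Finset α) : Finset (α → ℕ) := (finite_IsP k s S).toFinset

lemma mem_PS {k s : ℕ} {S : Finset α} {p : α → ℕ} : p ∈ PS k s S ↔ IsP k s S p := by
  simp [PS]

def dsp (k s : ℕ) (S : Finset α) (p : α → ℕ) : ℤ :=
  ∑ i ∈ range S.card, ((k : ℤ) * i + s - 1) - ∑ x, (p x : ℤ)

noncomputable def gP (q : ℚ) (k s : ℕ) (S : Finset α) : ℚ := ∑ p ∈ PS k s S, q ^ dsp k s S p

lemma gP_empty (q : ℚ) (k s : ℕ) : gP q k s (∅ : Finset α) = 1 := by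
  have : PS k s (∅ : Finset α) = {fun _ => 0} := by
    ext p
    rw [mem_PS, Finset.mem_singleton]
    constructor
    · intro h; funext x; exact h.1 x (by simp)
    · rintro rfl; exact ⟨fun _ _ => rfl, by simp⟩
  simp [gP, this, dsp]

def CondP (k s : ℕ) (T A : Finset α) (p : α → ℕ) : Prop :=
  A = T.filter (fun x => p x < k * A.card + s) ∧
    ∀ i < A.card, i < (T.filter (fun x => p x < k * i + s)).card

lemma condP_unique (k s : ℕ) (T : Finset α) (p : α → ℕ) :
    ∃ A ∈ T.powerset, CondP k s T A p ∧ ∀ B ∈ T.powerset, CondP k s T B p → B = A := by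
  have hex : ∃ i, (T.filter (fun x => p x < k * i + s)).card ≤ i :=
    ⟨T.card, Finset.card_le_card (Finset.filter_subset _ _)⟩
  classical
  obtain ⟨m, hm, hmin⟩ : ∃ m, (T.filter (fun x => p x < k * m + s)).card ≤ m ∧
      ∀ i < m, i < (T.filter (fun x => p x < k * i + s)).card :=
    ⟨Nat.find hex, Nat.find_spec hex, fun i hi => not_le.mp (Nat.find_min hex hi)⟩
  have hcard : (T.filter (fun x => p x < k * m + s)).card = m := by
    apply le_antisymm hm
    rcases Nat.eq_zero_or_pos m with h0 | h0
    · omega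
    · have h1 := hmin (m - 1) (by omega)
      have h2 : (T.filter (fun x => p x < k * (m - 1) + s)).card
          ≤ (T.filter (fun x => p x < k * m + s)).card := by
        apply Finset.card_le_card
        intro x hx
        rw [Finset.mem_filter] at hx ⊢
        have h3 : k * (m - 1) ≤ k * m := Nat.mul_le_mul_left _ (by omega)
        exact ⟨hx.1, by omega⟩
      omega
  have key : ∀ A B, CondP k s T A p → CondP k s T B p → ¬ A.card < B.card := by
    intro A B hA hB hlt
    have := hB.2 _ hlt
    rw [← hA.1] at this
    exact lt_irrefl _ this
  have hA : CondP k s T (T.filter (fun x => p x < k * m + s)) p := by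
    refine ⟨by rw [hcard], ?_⟩
    rw [hcard]; exact hmin
  refine ⟨_, by simp, hA, ?_⟩
  intro B _ hB
  have h1 := key _ _ hA hB
  have h2 := key _ _ hB hA
  have h3 : B.card = m := by omega
  rw [hB.1, h3]

lemma sum_cond_P (q : ℚ) (hq : q ≠ 0) (k s : ℕ) (S T A : Finset α) (v : α) (hv : v ∈ S)
    (hT : T = S.erase v) (hA : A ⊆ T) [DecidablePred (CondP k s T A)] :
    ∑ p ∈ (PS k s S).filter (CondP k s T A), q ^ dsp k s S p
      = brk q (k * A.card + s) * gP q k s A * gP q k k (T \ A) := by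
  set m := A.card with hm
  have hvT : v ∉ T := by simp [hT]
  have hvA : v ∉ A := fun h => hvT (hA h)
  have hS : S = insert v T := by rw [hT, Finset.insert_erase hv]
  have hcS : S.card = T.card + 1 := by rw [hS, Finset.card_insert_of_notMem hvT]
  have hcT : T.card = m + (T \ A).card := by
    rw [Finset.card_sdiff_of_subset hA]
    have := Finset.card_le_card hA
    omega
  have hbr : brk q (k * m + s) = ∑ a ∈ range (k * m + s), q ^ ((k : ℤ) * m + s - 1 - a) := by
    rw [brk, ← Finset.sum_range_reflect]
    apply Finset.sum_congr rfl
    intro a ha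
    rw [Finset.mem_range] at ha
    rw [← zpow_natCast]
    congr 1
    push_cast [show a ≤ k * m + s - 1 by omega, show 1 ≤ k * m + s by omega]
    ring
  rw [hbr, gP, gP, Finset.sum_mul_sum, Finset.sum_mul, Finset.sum_congr rfl
    (fun a _ => Finset.sum_mul_sum _ _ _ _)]
  rw [← Finset.sum_product', ← Finset.sum_product']
  refine Finset.sum_bij'
    (fun p _ => ((p v, fun x => if x ∈ A then p x else 0),
      fun x => if x ∈ T \ A then p x - (k * m + s) else 0))
    (fun t _ => fun x => if x = v then t.1.1 else if x ∈ A then t.1.2 x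
      else if x ∈ T then t.2 x + (k * m + s) else 0) ?_ ?_ ?_ ?_ ?_
  · intro p hp
    rw [Finset.mem_filter, mem_PS] at hp
    obtain ⟨hp, hC1, hC2⟩ := hp
    have hAiff : ∀ x ∈ T, (x ∈ A ↔ p x < k * m + s) := by
      intro x hx
      conv_lhs => rw [hC1]
      simp [hx, hm]
    simp only [Finset.mem_product, Finset.mem_range, mem_PS]
    refine ⟨⟨?_, ?_, ?_⟩, ?_, ?_⟩
    · by_contra hcon
      have h1 := hp.2 m (by omega)
      rw [hS, Finset.filter_insert, if_neg hcon, ← hC1] at h1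
      omega
    · intro x hx; simp [hx]
    · intro i hi
      refine lt_of_lt_of_le (hC2 i hi) (Finset.card_le_card ?_)
      intro x hx
      rw [Finset.mem_filter] at hx ⊢
      have h3 : k * i ≤ k * m := Nat.mul_le_mul_left _ (by omega)
      have hxA : x ∈ A := (hAiff x hx.1).mpr (by omega)
      refine ⟨hxA, ?_⟩
      beta_reduce; rw [if_pos hxA]; exact hx.2
    · intro x hx; beta_reduce; rw [if_neg hx]
    · intro i hi
      have h1 := hp.2 (m + i + 1) (by omega)
      have h2 : S.filter (fun x => p x < k * (m + i + 1) + s) ⊆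
          insert v (A ∪ (T \ A).filter (fun x =>
            (if x ∈ T \ A then p x - (k * m + s) else 0) < k * i + k)) := by
        intro x hx
        rw [Finset.mem_filter, hS, Finset.mem_insert] at hx
        rw [Finset.mem_insert, Finset.mem_union, Finset.mem_filter]
        rcases hx with ⟨rfl | hx, hlt⟩
        · left; rfl
        · right
          by_cases hxA : x ∈ A
          · left; exact hxA
          · right
            have hmem : x ∈ T \ A := Finset.mem_sdiff.mpr ⟨hx, hxA⟩
            refine ⟨hmem, ?_⟩
            rw [if_pos hmem]
            have := (hAiff x hx).not.mp hxA
            have e : k * (m + i + 1) = k * m + k * i + k := by ring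
            omega
      have h3 := Finset.card_le_card h2
      have h4 := Finset.card_insert_le v (A ∪ (T \ A).filter (fun x =>
            (if x ∈ T \ A then p x - (k * m + s) else 0) < k * i + k))
      have h5 := Finset.card_union_le A ((T \ A).filter (fun x =>
            (if x ∈ T \ A then p x - (k * m + s) else 0) < k * i + k))
      beta_reduce
      omega
  · rintro ⟨⟨a, p1⟩, p2⟩ ht
    simp only [Finset.mem_product, Finset.mem_range, mem_PS] at ht
    obtain ⟨⟨ha, hp1⟩, hp2⟩ := ht
    rw [Finset.mem_filter, mem_PS]
    set p : α → ℕ := fun x => if x = v then a else if x ∈ A then p1 x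
      else if x ∈ T then p2 x + (k * m + s) else 0 with hp
    have pv : p v = a := by simp [hp]
    have pA : ∀ x ∈ A, p x = p1 x := by
      intro x hx
      have : x ≠ v := fun h => hvA (h ▸ hx)
      simp [hp, this, hx]
    have pT : ∀ x ∈ T \ A, p x = p2 x + (k * m + s) := by
      intro x hx
      rw [Finset.mem_sdiff] at hx
      have : x ≠ v := fun h => hvT (h ▸ hx.1)
      simp [hp, this, hx.1, hx.2]
    have cnt : ∀ i < m, i < (T.filter (fun x => p x < k * i + s)).card := by
      intro i hi
      refine lt_of_lt_of_le (hp1.2 i hi) (Finset.card_le_card ?_)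
      intro x hx
      rw [Finset.mem_filter] at hx ⊢
      exact ⟨hA hx.1, by rw [pA x hx.1]; exact hx.2⟩
    refine ⟨⟨?_, ?_⟩, ?_, ?_⟩
    · intro x hx
      rw [hS, Finset.mem_insert, not_or] at hx
      have : x ∉ A := fun h => hx.2 (hA h)
      simp [hp, hx.1, hx.2, this]
    · intro i hi
      by_cases him : i < m
      · refine lt_of_lt_of_le (cnt i him) (Finset.card_le_card ?_)
        apply Finset.filter_subset_filter
        rw [hS]; exact Finset.subset_insert _ _
      · have hmi : k * m ≤ k * i := Nat.mul_le_mul_left _ (by omega)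
        have h2 : insert v (A ∪ (T \ A).filter (fun x => p x < k * i + s)) ⊆
            S.filter (fun x => p x < k * i + s) := by
          intro x hx
          rw [Finset.mem_insert, Finset.mem_union, Finset.mem_filter] at hx
          rw [Finset.mem_filter, hS, Finset.mem_insert]
          rcases hx with rfl | hx | hx
          · exact ⟨Or.inl rfl, by rw [pv]; omega⟩
          · refine ⟨Or.inr (hA hx), ?_⟩
            rw [pA x hx]
            have := hp1.bound_lt x hx
            rw [← hm] at this
            omega
          · exact ⟨Or.inr (Finset.mem_sdiff.mp hx.1).1, hx.2⟩
        have h3 := Finset.card_le_card h2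
        rw [Finset.card_insert_of_notMem, Finset.card_union_of_disjoint] at h3
        · by_cases hie : i = m
          · omega
          · have h4 := hp2.2 (i - m - 1) (by omega)
            have h5 : ((T \ A).filter (fun x => p2 x < k * (i - m - 1) + k)).card ≤
                ((T \ A).filter (fun x => p x < k * i + s)).card := by
              apply Finset.card_le_card
              intro x hx
              rw [Finset.mem_filter] at hx ⊢
              refine ⟨hx.1, ?_⟩
              rw [pT x hx.1]
              obtain ⟨d, rfl⟩ : ∃ d, i = m + d + 1 := ⟨i - m - 1, by omega⟩
              have e : k * (m + d + 1) = k * m + k * d + k := by ring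
              have h6 := hx.2
              rw [show m + d + 1 - m - 1 = d by omega] at h6
              omega
            omega
        · rw [Finset.disjoint_left]
          intro x hx hx2
          rw [Finset.mem_filter, Finset.mem_sdiff] at hx2
          exact hx2.1.2 hx
        · rw [Finset.mem_union, Finset.mem_filter, Finset.mem_sdiff]
          tauto
    · ext x
      rw [Finset.mem_filter]
      constructor
      · intro hx
        refine ⟨hA hx, ?_⟩
        rw [pA x hx]
        exact hp1.bound_lt x hx
      · rintro ⟨hx, hlt⟩
        by_contra hxA
        rw [pT x (Finset.mem_sdiff.mpr ⟨hx, hxA⟩), ← hm] at hlt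
        omega
    · exact cnt
  · intro p hp
    rw [Finset.mem_filter, mem_PS] at hp
    obtain ⟨hp, hC1, hC2⟩ := hp
    funext x
    simp only
    split_ifs with h1 h2 h3 h4
    · rw [h1]
    · rfl
    · have : ¬ p x < k * m + s := by
        intro hlt
        apply h2
        rw [hC1, Finset.mem_filter]
        exact ⟨h3, hlt⟩
      omega
    · exact absurd (Finset.mem_sdiff.mpr ⟨h3, h2⟩) h4
    · rw [hp.1]
      rw [hS, Finset.mem_insert]
      tauto
  · rintro ⟨⟨a, p1⟩, p2⟩ ht
    simp only [Finset.mem_product, Finset.mem_range, mem_PS] at ht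
    obtain ⟨⟨ha, hp1⟩, hp2⟩ := ht
    simp only [if_true]
    congr 1
    · congr 1
      funext x
      by_cases hx : x ∈ A
      · have : x ≠ v := fun h => hvA (h ▸ hx)
        simp [hx, this]
      · simp [hx, hp1.1 x hx]
    · funext x
      by_cases hx : x ∈ T \ A
      · rw [if_pos hx]
        rw [Finset.mem_sdiff] at hx
        have : x ≠ v := fun h => hvT (h ▸ hx.1)
        simp [hx, this]
      · rw [if_neg hx, hp2.1 x hx]
  · intro p hp
    rw [Finset.mem_filter, mem_PS] at hp
    obtain ⟨hp, hC1, hC2⟩ := hp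
    rw [← zpow_add₀ hq, ← zpow_add₀ hq]
    congr 1
    have hpt : ∀ x, (p x : ℤ) = (if x = v then (p v : ℤ) else 0)
        + ((if x ∈ A then p x else 0 : ℕ) : ℤ)
        + ((if x ∈ T \ A then p x - (k * m + s) else 0 : ℕ) : ℤ)
        + (if x ∈ T \ A then ((k * m + s : ℕ) : ℤ) else 0) := by
      intro x
      by_cases h1 : x = v
      · subst h1; simp [hvA, hvT]
      by_cases h2 : x ∈ A
      · simp [h1, h2]
      by_cases h3 : x ∈ T
      · have : ¬ p x < k * m + s := by
          intro hlt
          apply h2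
          rw [hC1, Finset.mem_filter]
          exact ⟨h3, hlt⟩
        simp only [h1, h2, Finset.mem_sdiff, h3, if_true, if_false, not_false_eq_true, and_self]
        push_cast [show k * m + s ≤ p x by omega]
        ring
      · have : p x = 0 := hp.1 x (by rw [hS, Finset.mem_insert]; tauto)
        simp [h1, h2, h3, this]
    have hsum : ∑ x, (p x : ℤ) = p v + ∑ x, ((if x ∈ A then p x else 0 : ℕ) : ℤ)
        + ∑ x, ((if x ∈ T \ A then p x - (k * m + s) else 0 : ℕ) : ℤ)
        + (T \ A).card * ((k * m + s : ℕ) : ℤ) := by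
      rw [Finset.sum_congr rfl (fun x _ => hpt x), Finset.sum_add_distrib, Finset.sum_add_distrib,
        Finset.sum_add_distrib]
      congr 1
      · congr 2
        simp
      · rw [Finset.sum_ite_mem, Finset.univ_inter, Finset.sum_const, nsmul_eq_mul]
    simp only [dsp]
    rw [hsum, hcS, hcT, show m + (T \ A).card + 1 = (m + 1) + (T \ A).card by ring,
      Finset.sum_range_add, Finset.sum_range_succ, ← hm]
    have e : ∑ x ∈ range (T \ A).card, ((k : ℤ) * ((m + 1 + x : ℕ) : ℤ) + s - 1)
        = ∑ i ∈ range (T \ A).card, ((k : ℤ) * i + k - 1) + (T \ A).card * ((k * m + s : ℕ) : ℤ) := by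
      rw [← nsmul_eq_mul, ← Finset.card_range (T \ A).card, ← Finset.sum_const, Finset.card_range,
        ← Finset.sum_add_distrib]
      apply Finset.sum_congr rfl
      intro i _
      push_cast
      ring
    rw [e]
    ring

lemma gP_step (q : ℚ) (hq : q ≠ 0) (k s : ℕ) (S : Finset α) (v : α) (hv : v ∈ S) :
    gP q k s S = ∑ A ∈ (S.erase v).powerset,
      brk q (k * A.card + s) * gP q k s A * gP q k k (S.erase v \ A) := by
  classical
  rw [gP, sum_part (PS k s S) (S.erase v).powerset (CondP k s (S.erase v))]
  · apply Finset.sum_congr rfl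
    intro A hA
    exact sum_cond_P q hq k s S _ A v hv rfl (Finset.mem_powerset.mp hA)
  · intro p _
    exact condP_unique k s (S.erase v) p

/-- numeric recursion -/
noncomputable def gnum (q : ℚ) (k : ℕ) : ℕ → ℕ → ℚ
  | _, 0 => 1
  | s, n + 1 => ∑ i : Fin (n + 1), (n.choose i : ℚ) *
      ((brk q (k * i + s) * gnum q k s i) * gnum q k k (n - i))
termination_by _ n => n
decreasing_by all_goals omega

lemma gnum_succ (q : ℚ) (k s n : ℕ) : gnum q k s (n + 1) = ∑ p ∈ HasAntidiagonal.antidiagonal n,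
    (n.choose p.1 : ℚ) * ((brk q (k * p.1 + s) * gnum q k s p.1) * gnum q k k p.2) := by
  rw [gnum, Finset.Nat.sum_antidiagonal_eq_sum_range_succ_mk, ← Fin.sum_univ_eq_sum_range
    (fun i => (n.choose i : ℚ) * ((brk q (k * i + s) * gnum q k s i) * gnum q k k (n - i)))]

lemma gP_eq (q : ℚ) (hq : q ≠ 0) (k n : ℕ) : ∀ (s : ℕ) (S : Finset α), S.card = n →
    gP q k s S = gnum q k s n := by
  induction n using Nat.strong_induction_on with
  | _ n ih =>
    intro s S hS
    cases n with
    | zero => rw [Finset.card_eq_zero.mp hS, gP_empty, gnum]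
    | succ n =>
      obtain ⟨v, hv⟩ : S.Nonempty := Finset.card_pos.mp (by omega)
      have hc : (S.erase v).card = n := by rw [Finset.card_erase_of_mem hv]; omega
      rw [gP_step q hq k s S v hv, gnum_succ, Finset.Nat.sum_antidiagonal_eq_sum_range_succ_mk]
      rw [Finset.sum_congr rfl (g := fun A =>
        (fun i => brk q (k * i + s) * gnum q k s i * gnum q k k (n - i)) A.card)]
      · rw [Finset.sum_powerset_apply_card
          (fun i => brk q (k * i + s) * gnum q k s i * gnum q k k (n - i)), hc]
        simp [nsmul_eq_mul]
      · intro A hA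
        rw [Finset.mem_powerset] at hA
        have h1 := Finset.card_le_card hA
        have h2 := Finset.card_sdiff_of_subset hA
        simp only
        rw [ih A.card (by omega) s A rfl, ih (n - A.card) (by omega) k _ (by omega)]

end Parking

open Finset

/-! ### Forest side -/
section Forest
set_option linter.unusedSectionVars false
set_option linter.unusedVariables false
variable {α : Type} [Fintype α] [LinearOrder α]

structure IsF (k s : ℕ) (S : Finset α) (x : (α → Option α) × (α → ℕ)) : Prop where
  out : ∀ a, a ∉ S → x.1 a = none
  outc : ∀ a, a ∉ S → x.2 a = 0
  par : ∀ a b, x.1 a = some b → b ∈ S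
  cr : ∀ a, a ∈ S → x.1 a = none → x.2 a < s
  cn : ∀ a b, x.1 a = some b → x.2 a < k
  rk : ∃ ρ : α → ℕ, ∀ a b, x.1 a = some b → ρ b < ρ a

lemma finite_IsF (k s : ℕ) (S : Finset α) : {x : (α → Option α) × (α → ℕ) | IsF k s S x}.Finite := by
  apply Set.Finite.subset (s := (Set.univ : Set (α → Option α)) ×ˢ
    {p : α → ℕ | ∀ x, p x ∈ Set.Iic (k + s)})
  · exact Set.Finite.prod Set.finite_univ (Set.Finite.pi' fun _ => Set.finite_Iic _)
  · rintro x hx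
    refine ⟨Set.mem_univ _, fun a => ?_⟩
    rw [Set.mem_Iic]
    by_cases ha : a ∈ S
    · cases h : x.1 a with
      | none => have := hx.cr a ha h; omega
      | some b => have := hx.cn a b h; omega
    · rw [hx.outc a ha]; omega

noncomputable def FS (k s : ℕ) (S : Finset α) : Finset ((α → Option α) × (α → ℕ)) :=
  (finite_IsF k s S).toFinset

lemma mem_FS {k s : ℕ} {S : Finset α} {p} : p ∈ FS k s S ↔ IsF k s S p := by
  simp [FS]

def Dd (f : α → Option α) (u v : α) : Prop := Relation.ReflTransGen (fun a b => f a = some b) v u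

lemma Dd_refl (f : α → Option α) (u : α) : Dd f u u := Relation.ReflTransGen.refl

lemma Dd_iff (f : α → Option α) (u v : α) : Dd f u v ↔ u = v ∨ ∃ w, f v = some w ∧ Dd f u w := by
  unfold Dd
  rw [Relation.ReflTransGen.cases_head_iff]
  constructor
  · rintro (h | h)
    · left; exact h.symm
    · right; exact h
  · rintro (h | h)
    · left; exact h.symm
    · right; exact h

lemma Dd_none {f : α → Option α} {u v : α} (h : f v = none) : Dd f u v ↔ u = v := by
  rw [Dd_iff]; simp [h]

lemma Dd_some {f : α → Option α} {u v w : α} (h : f v = some w) :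
    Dd f u v ↔ u = v ∨ Dd f u w := by
  rw [Dd_iff]; simp [h]

open Classical in
noncomputable def wv (x : (α → Option α) × (α → ℕ)) (v : α) : ℕ :=
  ∑ u, if Dd x.1 u v then x.2 u + (if v < u then 1 else 0) else 0

noncomputable def wt (x : (α → Option α) × (α → ℕ)) : ℕ := ∑ v, wv x v

noncomputable def gF (q : ℚ) (k s : ℕ) (S : Finset α) : ℚ := ∑ x ∈ FS k s S, q ^ wt x

lemma gF_empty (q : ℚ) (k s : ℕ) : gF q k s (∅ : Finset α) = 1 := by
  have : FS k s (∅ : Finset α) = {(fun _ => none, fun _ => 0)} := by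
    ext ⟨f, c⟩
    rw [mem_FS, Finset.mem_singleton]
    constructor
    · intro h
      have h1 : f = fun _ => none := funext fun x => h.out x (by simp)
      have h2 : c = fun _ => 0 := funext fun x => h.outc x (by simp)
      rw [h1, h2]
    · intro h
      rw [h]
      constructor <;> simp
  rw [gF, this]
  simp only [Finset.sum_singleton, wt, wv]
  rw [Finset.sum_eq_zero]
  · simp
  · intro v _
    apply Finset.sum_eq_zero
    intro u _
    rw [Dd_none rfl]
    split_ifs with h1 h2
    · subst h1; exact absurd h2 (lt_irrefl _)
    · rfl
    · rfl

/-- compatibility of a forest with its decomposition -/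
structure FRel (k s : ℕ) (S A : Finset α) (r : α) (j : ℕ)
    (x x1 x2 : (α → Option α) × (α → ℕ)) : Prop where
  hr : r ∈ A
  hA : A ⊆ S
  h1 : IsF k k (A.erase r) x1
  h2 : IsF k s (S \ A) x2
  fr : x.1 r = none
  cr : x.2 r = j
  fA : ∀ a ∈ A, a ≠ r → x.1 a = some ((x1.1 a).getD r)
  cA : ∀ a ∈ A, a ≠ r → x.2 a = x1.2 a
  fS : ∀ a, a ∉ A → x.1 a = x2.1 a
  cS : ∀ a, a ∉ A → x.2 a = x2.2 a

namespace FRel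
variable {k s : ℕ} {S A : Finset α} {r : α} {j : ℕ} {x x1 x2 : (α → Option α) × (α → ℕ)}

lemma D_out (h : FRel k s S A r j x x1 x2) (v : α) (hv : v ∉ A) :
    ∀ u, (Dd x.1 u v ↔ Dd x2.1 u v) ∧ (Dd x2.1 u v → u ∉ A) := by
  obtain ⟨ρ, hρ⟩ := h.h2.rk
  induction v using (measure ρ).wf.induction with
  | _ v ih =>
    intro u
    cases hf : x2.1 v with
    | none =>
      rw [Dd_none hf, Dd_none (by rw [h.fS v hv, hf])]
      exact ⟨Iff.rfl, fun h => h ▸ hv⟩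
    | some w =>
      have hw := h.h2.par v w hf
      rw [Finset.mem_sdiff] at hw
      have := ih w (hρ v w hf) hw.2 u
      rw [Dd_some hf, Dd_some (by rw [h.fS v hv, hf]), this.1]
      refine ⟨Iff.rfl, ?_⟩
      rintro (rfl | h')
      · exact hv
      · exact this.2 h'

lemma D_in (h : FRel k s S A r j x x1 x2) (v : α) (hv : v ∈ A) (hvr : v ≠ r) :
    ∀ u, (Dd x.1 u v ↔ u = r ∨ Dd x1.1 u v) ∧ (Dd x1.1 u v → u ∈ A ∧ u ≠ r) := by
  obtain ⟨ρ, hρ⟩ := h.h1.rk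
  induction v using (measure ρ).wf.induction with
  | _ v ih =>
    intro u
    cases hf : x1.1 v with
    | none =>
      have e : x.1 v = some r := by rw [h.fA v hv hvr, hf]; rfl
      rw [Dd_none hf, Dd_some e, Dd_none h.fr]
      refine ⟨or_comm, ?_⟩
      rintro rfl; exact ⟨hv, hvr⟩
    | some w =>
      have e : x.1 v = some w := by rw [h.fA v hv hvr, hf]; rfl
      have hw := h.h1.par v w hf
      rw [Finset.mem_erase] at hw
      have := ih w (hρ v w hf) hw.2 hw.1 u
      rw [Dd_some hf, Dd_some e, this.1]
      refine ⟨by tauto, ?_⟩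
      rintro (rfl | h')
      · exact ⟨hv, hvr⟩
      · exact this.2 h'

lemma D_root (h : FRel k s S A r j x x1 x2) (v : α) : v ∈ A ↔ Dd x.1 r v := by
  by_cases hv : v ∈ A
  · by_cases hvr : v = r
    · subst hvr; simp [hv, Dd_refl]
    · rw [(h.D_in v hv hvr r).1]; simp [hv]
  · rw [(h.D_out v hv r).1]
    simp only [hv, false_iff]
    intro h'
    exact (h.D_out v hv r).2 h' h.hr

lemma isF (h : FRel k s S A r j x x1 x2) (hj : j < s) : IsF k s S x := by
  have hrS := h.hA h.hr
  constructor
  · intro a ha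
    have haA : a ∉ A := fun h' => ha (h.hA h')
    rw [h.fS a haA, h.h2.out a (fun h' => ha (Finset.mem_sdiff.mp h').1)]
  · intro a ha
    have haA : a ∉ A := fun h' => ha (h.hA h')
    rw [h.cS a haA, h.h2.outc a (fun h' => ha (Finset.mem_sdiff.mp h').1)]
  · intro a b hab
    by_cases haA : a ∈ A
    · by_cases har : a = r
      · subst har; rw [h.fr] at hab; simp at hab
      · rw [h.fA a haA har] at hab
        cases hf : x1.1 a with
        | none => rw [hf] at hab; simp at hab; exact hab ▸ hrS
        | some w =>
          rw [hf] at hab; simp at hab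
          have := h.h1.par a w hf
          rw [Finset.mem_erase] at this
          exact hab ▸ h.hA this.2
    · rw [h.fS a haA] at hab
      exact (Finset.mem_sdiff.mp (h.h2.par a b hab)).1
  · intro a ha hn
    by_cases haA : a ∈ A
    · by_cases har : a = r
      · subst har; rw [h.cr]; exact hj
      · rw [h.fA a haA har] at hn; simp at hn
    · rw [h.cS a haA]
      rw [h.fS a haA] at hn
      exact h.h2.cr a (Finset.mem_sdiff.mpr ⟨ha, haA⟩) hn
  · intro a b hab
    by_cases haA : a ∈ A
    · by_cases har : a = r
      · subst har; rw [h.fr] at hab; simp at hab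
      · rw [h.cA a haA har]
        cases hf : x1.1 a with
        | none => exact h.h1.cr a (Finset.mem_erase.mpr ⟨har, haA⟩) hf
        | some w => exact h.h1.cn a w hf
    · rw [h.fS a haA] at hab
      rw [h.cS a haA]
      exact h.h2.cn a b hab
  · obtain ⟨ρ1, hρ1⟩ := h.h1.rk
    obtain ⟨ρ2, hρ2⟩ := h.h2.rk
    refine ⟨fun a => if a = r then 0 else if a ∈ A then ρ1 a + 1 else ρ2 a, ?_⟩
    intro a b hab
    by_cases haA : a ∈ A
    · by_cases har : a = r
      · subst har; rw [h.fr] at hab; simp at hab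
      · rw [h.fA a haA har] at hab
        cases hf : x1.1 a with
        | none => rw [hf] at hab; simp at hab; subst hab; simp [har, haA]
        | some w =>
          rw [hf] at hab; simp at hab
          subst hab
          have h3 := h.h1.par a w hf
          rw [Finset.mem_erase] at h3
          have := hρ1 a w hf
          simp [har, haA, h3.1, h3.2, this]
    · rw [h.fS a haA] at hab
      have h3 := Finset.mem_sdiff.mp (h.h2.par a b hab)
      have har : a ≠ r := fun e => haA (e ▸ h.hr)
      have hbr : b ≠ r := fun e => h3.2 (e ▸ h.hr)
      simp [har, haA, hbr, h3.2, hρ2 a b hab]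

lemma wv_zero {x : (α → Option α) × (α → ℕ)} {v : α} (hf : x.1 v = none) :
    wv x v = x.2 v := by
  unfold wv
  rw [Finset.sum_eq_single v]
  · simp [Dd_refl]
  · intro u _ hu
    rw [Dd_none hf, if_neg hu]
  · simp

open Classical in
lemma wv_eq (h : FRel k s S A r j x x1 x2) (v : α) :
    wv x v = (if v ∈ A then j + (if v < r then 1 else 0) else 0) + wv x1 v + wv x2 v := by
  by_cases hv : v ∈ A
  · have e2 : wv x2 v = 0 := by
      have hv2 : v ∉ S \ A := fun h' => (Finset.mem_sdiff.mp h').2 hv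
      rw [wv_zero (h.h2.out v hv2), h.h2.outc v hv2]
    rw [e2, if_pos hv, add_zero]
    by_cases hvr : v = r
    · subst hvr
      have hv2 : v ∉ A.erase v := by simp
      rw [wv_zero h.fr, wv_zero (h.h1.out v hv2), h.h1.outc v hv2, h.cr]
      simp
    · unfold wv
      rw [← Finset.add_sum_erase _ _ (Finset.mem_univ r),
        ← Finset.add_sum_erase (a := r) (s := univ) (f := fun u =>
          if Dd x1.1 u v then x1.2 u + (if v < u then 1 else 0) else 0) (Finset.mem_univ r)]
      have hr1 : ¬ Dd x1.1 r v := fun h' => ((h.D_in v hv hvr r).2 h').2 rfl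
      rw [if_neg hr1, if_pos ((h.D_root v).mp hv), h.cr, zero_add]
      congr 1
      apply Finset.sum_congr rfl
      intro u hu
      have hur := Finset.ne_of_mem_erase hu
      have := h.D_in v hv hvr u
      by_cases hd : Dd x1.1 u v
      · rw [if_pos hd, if_pos (this.1.mpr (Or.inr hd)), h.cA u (this.2 hd).1 hur]
      · rw [if_neg hd, if_neg]
        rw [this.1]; tauto
  · have hv2 : v ∉ A.erase r := fun h' => hv (Finset.mem_of_mem_erase h')
    rw [if_neg hv, wv_zero (h.h1.out v hv2), h.h1.outc v hv2, zero_add, zero_add]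
    unfold wv
    apply Finset.sum_congr rfl
    intro u _
    have := h.D_out v hv u
    by_cases hd : Dd x2.1 u v
    · rw [if_pos hd, if_pos (this.1.mpr hd), h.cS u (this.2 hd)]
    · rw [if_neg hd, if_neg]
      rw [this.1]; exact hd

lemma wt_eq (h : FRel k s S A r j x x1 x2) :
    wt x = j * A.card + (A.filter (· < r)).card + wt x1 + wt x2 := by
  unfold wt
  rw [Finset.sum_congr rfl (fun v _ => h.wv_eq v), Finset.sum_add_distrib, Finset.sum_add_distrib]
  congr 2
  rw [Finset.sum_ite_mem, Finset.univ_inter, Finset.sum_add_distrib, Finset.sum_const,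
    Finset.card_filter, smul_eq_mul, mul_comm]

end FRel

def CondF (A : Finset α) (r : α) (x : (α → Option α) × (α → ℕ)) : Prop :=
  x.1 r = none ∧ ∀ a, a ∈ A ↔ Dd x.1 r a

def res1 (A : Finset α) (r : α) (x : (α → Option α) × (α → ℕ)) : (α → Option α) × (α → ℕ) :=
  (fun a => if a ∈ A.erase r then (if x.1 a = some r then none else x.1 a) else none,
   fun a => if a ∈ A.erase r then x.2 a else 0)

def res2 (A : Finset α) (x : (α → Option α) × (α → ℕ)) : (α → Option α) × (α → ℕ) :=
  (fun a => if a ∈ A then none else x.1 a, fun a => if a ∈ A then 0 else x.2 a)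

def glue (A : Finset α) (r : α) (j : ℕ) (x1 x2 : (α → Option α) × (α → ℕ)) :
    (α → Option α) × (α → ℕ) :=
  (fun a => if a = r then none else if a ∈ A then some ((x1.1 a).getD r) else x2.1 a,
   fun a => if a = r then j else if a ∈ A then x1.2 a else x2.2 a)

lemma rel_glue {k s : ℕ} {S A : Finset α} {r : α} (hr : r ∈ A) (hA : A ⊆ S) (j : ℕ)
    {x1 x2 : (α → Option α) × (α → ℕ)} (h1 : IsF k k (A.erase r) x1) (h2 : IsF k s (S \ A) x2) :
    FRel k s S A r j (glue A r j x1 x2) x1 x2 := by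
  have hne : ∀ a, a ∉ A → a ≠ r := fun a ha e => ha (e ▸ hr)
  refine ⟨hr, hA, h1, h2, by simp [glue], by simp [glue], ?_, ?_, ?_, ?_⟩
  · intro a ha har; simp [glue, ha, har]
  · intro a ha har; simp [glue, ha, har]
  · intro a ha; simp [glue, ha, hne a ha]
  · intro a ha; simp [glue, ha, hne a ha]

lemma rel_res {k s : ℕ} {S A : Finset α} {r : α} (hr : r ∈ A) (hA : A ⊆ S)
    {x : (α → Option α) × (α → ℕ)} (h : IsF k s S x) (hC : CondF A r x) :
    FRel k s S A r (x.2 r) x (res1 A r x) (res2 A x) := by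
  obtain ⟨hC1, hC2⟩ := hC
  have hpar : ∀ a ∈ A, a ≠ r → ∃ w ∈ A, x.1 a = some w := by
    intro a ha har
    rw [hC2, Dd_iff] at ha
    rcases ha with ha | ⟨w, hw, hD⟩
    · exact absurd ha.symm har
    · exact ⟨w, (hC2 w).mpr hD, hw⟩
  have hout : ∀ a b, a ∉ A → x.1 a = some b → b ∉ A := by
    intro a b ha hab hb
    apply ha
    rw [hC2] at hb ⊢
    rw [Dd_some hab]; right; exact hb
  obtain ⟨ρ, hρ⟩ := h.rk
  refine ⟨hr, hA, ?_, ?_, hC1, rfl, ?_, ?_, ?_, ?_⟩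
  · have hs : ∀ a b, (res1 A r x).1 a = some b → a ∈ A.erase r ∧ x.1 a = some b ∧ b ≠ r := by
      intro a b hab
      simp only [res1] at hab
      split_ifs at hab with h1 h2
      refine ⟨h1, hab, ?_⟩
      rintro rfl; exact h2 hab
    constructor
    · intro a ha; simp only [res1]; rw [if_neg ha]
    · intro a ha; simp only [res1]; rw [if_neg ha]
    · intro a b hab
      obtain ⟨h1, h2, h3⟩ := hs a b hab
      rw [Finset.mem_erase] at h1
      obtain ⟨w, hw, hw2⟩ := hpar a h1.2 h1.1
      rw [h2] at hw2
      rw [Finset.mem_erase]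
      exact ⟨h3, (Option.some.inj hw2) ▸ hw⟩
    · intro a ha _
      simp only [res1]; rw [if_pos ha]
      rw [Finset.mem_erase] at ha
      obtain ⟨w, hw, hw2⟩ := hpar a ha.2 ha.1
      exact h.cn a w hw2
    · intro a b hab
      obtain ⟨h1, h2, h3⟩ := hs a b hab
      simp only [res1]; rw [if_pos h1]
      exact h.cn a b h2
    · exact ⟨ρ, fun a b hab => hρ a b (hs a b hab).2.1⟩
  · have hs : ∀ a b, (res2 A x).1 a = some b → a ∉ A ∧ x.1 a = some b := by
      intro a b hab
      simp only [res2] at hab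
      split_ifs at hab with h1
      exact ⟨h1, hab⟩
    constructor
    · intro a ha; simp only [res2]
      rw [Finset.mem_sdiff] at ha
      split_ifs with h1
      · rfl
      · exact h.out a (by tauto)
    · intro a ha; simp only [res2]
      rw [Finset.mem_sdiff] at ha
      split_ifs with h1
      · rfl
      · exact h.outc a (by tauto)
    · intro a b hab
      obtain ⟨h1, h2⟩ := hs a b hab
      exact Finset.mem_sdiff.mpr ⟨h.par a b h2, hout a b h1 h2⟩
    · intro a ha hn
      rw [Finset.mem_sdiff] at ha
      simp only [res2] at hn ⊢
      rw [if_neg ha.2] at hn ⊢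
      exact h.cr a ha.1 hn
    · intro a b hab
      obtain ⟨h1, h2⟩ := hs a b hab
      simp only [res2]; rw [if_neg h1]
      exact h.cn a b h2
    · exact ⟨ρ, fun a b hab => hρ a b (hs a b hab).2⟩
  · intro a ha har
    obtain ⟨w, hw, hw2⟩ := hpar a ha har
    simp only [res1]
    rw [if_pos (Finset.mem_erase.mpr ⟨har, ha⟩), hw2]
    split_ifs with h1
    · simpa using h1
    · rfl
  · intro a ha har
    simp only [res1]
    rw [if_pos (Finset.mem_erase.mpr ⟨har, ha⟩)]
  · intro a ha; simp only [res2]; rw [if_neg ha]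
  · intro a ha; simp only [res2]; rw [if_neg ha]

lemma glue_res {k s : ℕ} {S A : Finset α} {r : α} {j : ℕ}
    {x x1 x2 : (α → Option α) × (α → ℕ)} (h : FRel k s S A r j x x1 x2) :
    glue A r j x1 x2 = x := by
  apply Prod.ext
  · funext a
    simp only [glue]
    split_ifs with h1 h2
    · rw [h1, h.fr]
    · rw [h.fA a h2 h1]
    · rw [h.fS a h2]
  · funext a
    simp only [glue]
    split_ifs with h1 h2
    · rw [h1, h.cr]
    · rw [h.cA a h2 h1]
    · rw [h.cS a h2]

lemma res1_rel {k s : ℕ} {S A : Finset α} {r : α} {j : ℕ}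
    {x x1 x2 : (α → Option α) × (α → ℕ)} (h : FRel k s S A r j x x1 x2) :
    res1 A r x = x1 := by
  apply Prod.ext
  · funext a
    simp only [res1]
    split_ifs with h1 h2
    · rw [Finset.mem_erase] at h1
      rw [h.fA a h1.2 h1.1] at h2
      cases hf : x1.1 a with
      | none => rfl
      | some w =>
        rw [hf] at h2
        have := h.h1.par a w hf
        simp at h2
        simp [h2] at this
    · rw [Finset.mem_erase] at h1
      rw [h.fA a h1.2 h1.1] at h2 ⊢
      cases hf : x1.1 a with
      | none => rw [hf] at h2; simp at h2
      | some w => rfl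
    · rw [h.h1.out a h1]
  · funext a
    simp only [res1]
    split_ifs with h1
    · rw [Finset.mem_erase] at h1
      rw [h.cA a h1.2 h1.1]
    · rw [h.h1.outc a h1]

lemma res2_rel {k s : ℕ} {S A : Finset α} {r : α} {j : ℕ}
    {x x1 x2 : (α → Option α) × (α → ℕ)} (h : FRel k s S A r j x x1 x2) :
    res2 A x = x2 := by
  apply Prod.ext
  · funext a
    simp only [res2]
    split_ifs with h1
    · rw [h.h2.out a (fun h' => (Finset.mem_sdiff.mp h').2 h1)]
    · rw [h.fS a h1]
  · funext a
    simp only [res2]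
    split_ifs with h1
    · rw [h.h2.outc a (fun h' => (Finset.mem_sdiff.mp h').2 h1)]
    · rw [h.cS a h1]

lemma sum_cond_F (q : ℚ) (k s : ℕ) (S A : Finset α) (r : α) (hr : r ∈ A) (hA : A ⊆ S)
    [DecidablePred (CondF A r)] :
    ∑ x ∈ (FS k s S).filter (CondF A r), q ^ wt x
      = (∑ j ∈ range s, q ^ (j * A.card)) * q ^ (A.filter (· < r)).card
        * gF q k k (A.erase r) * gF q k s (S \ A) := by
  rw [Finset.sum_mul, gF, gF, Finset.sum_mul_sum, Finset.sum_mul, Finset.sum_congr rfl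
    (fun a _ => Finset.sum_mul_sum _ _ _ _)]
  rw [← Finset.sum_product', ← Finset.sum_product']
  refine Finset.sum_bij'
    (fun x _ => ((x.2 r, res1 A r x), res2 A x))
    (fun t _ => glue A r t.1.1 t.1.2 t.2) ?_ ?_ ?_ ?_ ?_
  · intro x hx
    rw [Finset.mem_filter, mem_FS] at hx
    have h := rel_res hr hA hx.1 hx.2
    simp only [Finset.mem_product, Finset.mem_range, mem_FS]
    exact ⟨⟨hx.1.cr r (hA hr) hx.2.1, h.h1⟩, h.h2⟩
  · rintro ⟨⟨j, x1⟩, x2⟩ ht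
    simp only [Finset.mem_product, Finset.mem_range, mem_FS] at ht
    have h := rel_glue hr hA j ht.1.2 ht.2
    rw [Finset.mem_filter, mem_FS]
    exact ⟨h.isF ht.1.1, h.fr, h.D_root⟩
  · intro x hx
    rw [Finset.mem_filter, mem_FS] at hx
    exact glue_res (rel_res hr hA hx.1 hx.2)
  · rintro ⟨⟨j, x1⟩, x2⟩ ht
    simp only [Finset.mem_product, Finset.mem_range, mem_FS] at ht
    have h := rel_glue hr hA j ht.1.2 ht.2
    simp only [res1_rel h, res2_rel h, h.cr]
  · intro x hx
    rw [Finset.mem_filter, mem_FS] at hx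
    have h := rel_res hr hA hx.1 hx.2
    rw [h.wt_eq, pow_add, pow_add, pow_add]

lemma condF_unique {k s : ℕ} {S : Finset α} {x : (α → Option α) × (α → ℕ)} (h : IsF k s S x)
    (v : α) (hv : v ∈ S) :
    ∃ t ∈ (S.erase v).powerset.sigma (fun B => insert v B), CondF (insert v t.1) t.2 x ∧
      ∀ t' ∈ (S.erase v).powerset.sigma (fun B => insert v B), CondF (insert v t'.1) t'.2 x →
        t' = t := by
  classical
  obtain ⟨ρ, hρ⟩ := h.rk
  have hex : ∃ r ∈ S, x.1 r = none ∧ Dd x.1 r v ∧ ∀ r', x.1 r' = none → Dd x.1 r' v → r' = r := by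
    induction v using (measure ρ).wf.induction with
    | _ v ih =>
      cases hf : x.1 v with
      | none => exact ⟨v, hv, hf, Dd_refl _ _, fun r' _ hd => (Dd_none hf).mp hd⟩
      | some w =>
        obtain ⟨r, h1, h2, h3, h4⟩ := ih w (hρ v w hf) (h.par v w hf)
        refine ⟨r, h1, h2, (Dd_some hf).mpr (Or.inr h3), ?_⟩
        intro r' hr' hd
        rw [Dd_some hf] at hd
        rcases hd with rfl | hd
        · rw [hf] at hr'; simp at hr'
        · exact h4 r' hr' hd
  obtain ⟨r, hrS, hr0, hrv, huniq⟩ := hex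
  have hDS : ∀ a, Dd x.1 r a → a ∈ S := by
    intro a ha
    by_contra hn
    rw [Dd_none (h.out a hn)] at ha
    exact hn (ha ▸ hrS)
  have hins : ∀ a, a ∈ insert v ((univ.filter (fun a => Dd x.1 r a)).erase v) ↔ Dd x.1 r a := by
    intro a
    rw [Finset.insert_erase (by simp [hrv])]
    simp
  refine ⟨⟨(univ.filter (fun a => Dd x.1 r a)).erase v, r⟩, ?_, ⟨hr0, hins⟩, ?_⟩
  · rw [Finset.mem_sigma]
    refine ⟨?_, (hins r).mpr (Dd_refl _ _)⟩
    rw [Finset.mem_powerset]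
    apply Finset.erase_subset_erase
    intro a ha
    exact hDS a (by simpa using ha)
  · rintro ⟨B, r'⟩ ht ⟨hc1, hc2⟩
    rw [Finset.mem_sigma, Finset.mem_powerset] at ht
    simp only at ht hc1 hc2
    have hr' : r' = r := huniq r' hc1 ((hc2 v).mp (Finset.mem_insert_self _ _))
    subst hr'
    have hB : B = (univ.filter (fun a => Dd x.1 r' a)).erase v := by
      have hvB : v ∉ B := fun h' => by simpa using ht.1 h'
      rw [← Finset.erase_insert hvB]
      congr 1
      ext a
      rw [hc2]; simp
    rw [hB]

lemma gF_step (q : ℚ) (hq : q ≠ 1) (k s n : ℕ) (S : Finset α) (v : α) (hv : v ∈ S)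
    (φ : ℕ → ℚ) (hφ : ∀ T : Finset α, T.card < S.card → gF q k k T = φ T.card) :
    gF q k s S = ∑ B ∈ (S.erase v).powerset,
      brk q (s * (B.card + 1)) * φ B.card * gF q k s (S \ insert v B) := by
  classical
  rw [gF, sum_part (FS k s S) ((S.erase v).powerset.sigma (fun B => insert v B))
    (fun t => CondF (insert v t.1) t.2)]
  · rw [Finset.sum_sigma]
    apply Finset.sum_congr rfl
    intro B hB
    rw [Finset.mem_powerset] at hB
    have hvB : v ∉ B := fun h' => by simpa using hB h'
    have hA : insert v B ⊆ S := by
      rw [← Finset.insert_erase hv]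
      exact Finset.insert_subset_insert _ hB
    have hcA := Finset.card_insert_of_notMem hvB
    have hle := Finset.card_le_card hA
    have hcard : ∀ r ∈ insert v B, ((insert v B).erase r).card = B.card := by
      intro r hr
      rw [Finset.card_erase_of_mem hr]; omega
    rw [Finset.sum_congr rfl (fun r hr => sum_cond_F q k s S (insert v B) r hr hA)]
    rw [Finset.sum_congr rfl (g := fun r => q ^ ((insert v B).filter (· < r)).card *
      ((∑ j ∈ range s, q ^ (j * (insert v B).card)) * φ B.card * gF q k s (S \ insert v B)))]
    · rw [← Finset.sum_mul, sum_rank, hcA, ← brk_comp q hq]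
      ring
    · intro r hr
      rw [hφ _ (by rw [hcard r hr]; omega), hcard r hr]
      ring
  · intro x hx
    exact condF_unique (mem_FS.mp hx) v hv

/-- numeric recursion -/
noncomputable def fnum (q : ℚ) (k : ℕ) : ℕ → ℕ → ℚ
  | _, 0 => 1
  | s, n + 1 => ∑ i : Fin (n + 1), (n.choose i : ℚ) *
      ((brk q (s * (i + 1)) * fnum q k k i) * fnum q k s (n - i))
termination_by _ n => n
decreasing_by all_goals omega

lemma fnum_succ (q : ℚ) (k s n : ℕ) : fnum q k s (n + 1) = ∑ p ∈ HasAntidiagonal.antidiagonal n,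
    (n.choose p.1 : ℚ) * ((brk q (s * (p.1 + 1)) * fnum q k k p.1) * fnum q k s p.2) := by
  rw [fnum, Finset.Nat.sum_antidiagonal_eq_sum_range_succ_mk, ← Fin.sum_univ_eq_sum_range
    (fun i => (n.choose i : ℚ) * ((brk q (s * (i + 1)) * fnum q k k i) * fnum q k s (n - i)))]

lemma gF_eq (q : ℚ) (hq : q ≠ 1) (k n : ℕ) : ∀ (s : ℕ) (S : Finset α), S.card = n →
    gF q k s S = fnum q k s n := by
  induction n using Nat.strong_induction_on with
  | _ n ih =>
    intro s S hS
    cases n with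
    | zero => rw [Finset.card_eq_zero.mp hS, gF_empty, fnum]
    | succ n =>
      obtain ⟨v, hv⟩ : S.Nonempty := Finset.card_pos.mp (by omega)
      have hc : (S.erase v).card = n := by rw [Finset.card_erase_of_mem hv]; omega
      rw [gF_step q hq k s n S v hv (fnum q k k) (fun T hT => ih _ (by omega) k T rfl),
        fnum_succ, Finset.Nat.sum_antidiagonal_eq_sum_range_succ_mk]
      rw [Finset.sum_congr rfl (g := fun A =>
        (fun i => brk q (s * (i + 1)) * fnum q k k i * fnum q k s (n - i)) A.card)]
      · rw [Finset.sum_powerset_apply_card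
          (fun i => brk q (s * (i + 1)) * fnum q k k i * fnum q k s (n - i)), hc]
        simp [nsmul_eq_mul]
      · intro B hB
        rw [Finset.mem_powerset] at hB
        have h1 := Finset.card_le_card hB
        have hvB : v ∉ B := fun h' => by simpa using hB h'
        have hA : insert v B ⊆ S := by
          rw [← Finset.insert_erase hv]
          exact Finset.insert_subset_insert _ hB
        have h2 := Finset.card_sdiff_of_subset hA
        rw [Finset.card_insert_of_notMem hvB] at h2
        simp only
        rw [ih (n - B.card) (by omega) s _ (by omega)]

lemma gF_eq_gP (q : ℚ) (hq0 : q ≠ 0) (hq : q ≠ 1) (k s : ℕ) (S : Finset α) :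
    gF q k s S = gP q k s S := by
  rw [gF_eq q hq k _ s S rfl, gP_eq q hq0 k _ s S rfl]
  apply two_rec_eq q hq k (fnum q k) (gnum q k)
  · intro s; rw [fnum]
  · intro s; rw [gnum]
  · exact fnum_succ q k
  · exact gnum_succ q k

end Forest

section Final
open Finset

lemma isParking_iff (k : ℕ) {n : ℕ} (p : Fin n → ℕ) :
    IsParkingFunction k p ↔ IsP k 1 univ p := by
  have key : ∀ i : Fin n, p (Tuple.sort p i) ≤ k * i ↔
      (i : ℕ) < (univ.filter (fun x => p x < k * (i : ℕ) + 1)).card := by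
    intro i
    have h := Tuple.lt_card_le_iff_apply_le_of_monotone (f := p ∘ Tuple.sort p)
      (Tuple.monotone_sort p) (a := k * (i : ℕ)) (j := i)
    have hc : (univ.filter (fun x => p x < k * (i : ℕ) + 1)).card =
        (univ.filter (fun x => (p ∘ Tuple.sort p) x ≤ k * (i : ℕ))).card := by
      symm
      apply Finset.card_equiv (Tuple.sort p)
      intro x
      simp [Nat.lt_succ_iff]
    rw [hc]
    exact h.symm
  unfold IsParkingFunction IsP
  constructor
  · intro h
    refine ⟨fun x hx => absurd (mem_univ x) hx, ?_⟩
    intro i hi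
    have hi' : i < n := by simpa using hi
    exact (key ⟨i, hi'⟩).mp (h ⟨i, hi'⟩)
  · intro h i
    exact (key i).mpr (h.2 i (by simp))

lemma dispk_eq (k : ℕ) {n : ℕ} (p : Fin n → ℕ) : dispk k p = dsp k 1 univ p := by
  unfold dispk dsp
  congr 1
  rw [Finset.card_univ, Fintype.card_fin]
  have : ∑ i ∈ range n, ((k : ℤ) * i + ((1 : ℕ) : ℤ) - 1) = k * ((∑ i ∈ range n, i : ℕ) : ℤ) := by
    rw [Nat.cast_sum, Finset.mul_sum]
    apply Finset.sum_congr rfl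
    intro i _
    push_cast; ring
  rw [this, Finset.sum_range_id, Nat.choose_two_right]

lemma dispk_nonneg (k : ℕ) {n : ℕ} (p : Fin n → ℕ) (h : IsParkingFunction k p) :
    0 ≤ dispk k p := by
  unfold dispk
  rw [← Equiv.sum_comp (Tuple.sort p) (fun i => (p i : ℤ))]
  have h1 : ∑ i : Fin n, (p (Tuple.sort p i) : ℤ) ≤ ∑ i : Fin n, ((k * (i : ℕ) : ℕ) : ℤ) :=
    Finset.sum_le_sum fun i _ => by exact_mod_cast h i
  have h2 : ∑ i : Fin n, ((k * (i : ℕ) : ℕ) : ℤ) = k * (n.choose 2 : ℤ) := by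
    rw [Fin.sum_univ_eq_sum_range (fun i => ((k * i : ℕ) : ℤ)), ← Nat.cast_sum,
      ← Finset.mul_sum, Finset.sum_range_id, Nat.choose_two_right]
    push_cast; rfl
  linarith

lemma dd_iff_desc {V : Type} (F : RootedForest V) (u v : V) :
    Dd F.parent u v ↔ v = u ∨ F.Desc u v := by
  unfold Dd RootedForest.Desc
  rw [Relation.reflTransGen_iff_eq_or_transGen]
  constructor
  · rintro (h | h)
    · exact Or.inl h.symm
    · exact Or.inr h
  · rintro (h | h)
    · exact Or.inl h.symm
    · exact Or.inr h

lemma invk_eq {n k : ℕ} (F : KForest n k) : KForest.invk F = wt (F.parent, F.colour) := by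
  classical
  have hh : ∀ u, F.toRootedForest.h u = (univ.filter (fun v => Dd F.parent u v)).card := by
    intro u
    unfold RootedForest.h RootedForest.hook
    rw [← Set.ncard_coe_finset]
    congr 1
    ext v
    simp [dd_iff_desc]
  have hinv : F.toRootedForest.inv =
      ∑ u, ∑ v, if Dd F.parent u v then (if v < u then 1 else 0) else 0 := by
    have : F.toRootedForest.inv =
        ((univ : Finset (Fin n × Fin n)).filter (fun t => Dd F.parent t.1 t.2 ∧ t.2 < t.1)).card := by
      unfold RootedForest.inv
      rw [← Set.ncard_coe_finset]
      congr 1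
      ext t
      simp only [Set.mem_setOf_eq, Finset.coe_filter, Finset.mem_univ, true_and, dd_iff_desc]
      constructor
      · rintro ⟨h1, h2⟩; exact ⟨Or.inr h1, h2⟩
      · rintro ⟨h1 | h1, h2⟩
        · exact absurd h1 h2.ne
        · exact ⟨h1, h2⟩
    rw [this, Finset.card_filter, Fintype.sum_prod_type]
    refine Finset.sum_congr rfl fun u _ => Finset.sum_congr rfl fun v _ => ?_
    by_cases h1 : Dd F.parent u v <;> by_cases h2 : v < u <;> simp [h1, h2]
  have hchr : F.chr = ∑ u, ∑ v, if Dd F.parent u v then F.colour u else 0 := by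
    unfold KForest.chr
    rw [Finset.sum_filter]
    refine Finset.sum_congr rfl fun u _ => ?_
    rw [← Finset.sum_filter, Finset.sum_const, smul_eq_mul, hh, mul_comm]
    split_ifs with h
    · rfl
    · rw [F.colour_root u (by simpa using h), mul_zero]
  unfold KForest.invk wt wv
  rw [hinv, hchr, Finset.sum_comm, Finset.sum_comm (f := fun u v => if Dd F.parent u v then F.colour u else 0), ← Finset.sum_add_distrib]
  refine Finset.sum_congr rfl fun v _ => ?_
  rw [← Finset.sum_add_distrib]
  refine Finset.sum_congr rfl fun u _ => ?_
  by_cases h1 : Dd F.parent u v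
  · simp [h1, add_comm]
  · simp [h1]

noncomputable def forestEquiv (n k : ℕ) (hk : 1 ≤ k) :
    KForest n k ≃ {x // x ∈ FS k 1 (univ : Finset (Fin n))} where
  toFun F := ⟨(F.parent, F.colour), by
    classical
    rw [mem_FS]
    refine ⟨fun a ha => absurd (mem_univ a) ha, fun a ha => absurd (mem_univ a) ha,
      fun _ b _ => mem_univ b, ?_, fun a _ _ => F.colour_lt a, ?_⟩
    · intro a _ h
      rw [show (F.parent, F.colour).2 a = 0 from F.colour_root a h]
      exact Nat.one_pos
    · refine ⟨fun a => (univ.filter (fun b =>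
        Relation.TransGen (fun a b => F.parent a = some b) a b)).card, ?_⟩
      intro a b hab
      apply Finset.card_lt_card
      rw [Finset.ssubset_iff_of_subset]
      · refine ⟨b, ?_, ?_⟩
        · simp only [mem_filter, mem_univ, true_and]
          exact Relation.TransGen.single hab
        · simp only [mem_filter, mem_univ, true_and]
          exact F.acyclic b
      · intro c hc
        simp only [mem_filter, mem_univ, true_and] at hc ⊢
        exact Relation.TransGen.head hab hc⟩
  invFun x :=
    { parent := x.1.1
      acyclic := by
        intro v hv
        obtain ⟨ρ, hρ⟩ := (mem_FS.mp x.2).rk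
        have : ∀ a b, Relation.TransGen (fun a b => x.1.1 a = some b) a b → ρ b < ρ a := by
          intro a b h
          induction h with
          | single h => exact hρ _ _ h
          | tail _ h ih => exact lt_trans (hρ _ _ h) ih
        exact lt_irrefl _ (this v v hv)
      colour := x.1.2
      colour_lt := by
        intro v
        cases h : x.1.1 v with
        | none => exact lt_of_lt_of_le ((mem_FS.mp x.2).cr v (mem_univ v) h) hk
        | some w => exact (mem_FS.mp x.2).cn v w h
      colour_root := by
        intro v h
        have := (mem_FS.mp x.2).cr v (mem_univ v) h
        omega }
  left_inv F := rfl
  right_inv x := rfl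

noncomputable def parkingEquiv (n k : ℕ) :
    {x // x ∈ PS k 1 (univ : Finset (Fin n))} ≃ {p : Fin n → ℕ // IsParkingFunction k p} :=
  Equiv.subtypeEquivRight fun p => by rw [mem_PS, isParking_iff]

lemma exists_bij (n k : ℕ) (hk : 1 ≤ k) :
    ∃ β : KForest n k ≃ {p : Fin n → ℕ // IsParkingFunction k p},
      ∀ F : KForest n k, dispk k (β F).1 = (KForest.invk F : ℤ) := by
  have hnn : ∀ y : {x // x ∈ PS k 1 (univ : Finset (Fin n))}, 0 ≤ dispk k y.1 := fun y =>
    dispk_nonneg k y.1 ((isParking_iff k y.1).mpr (mem_PS.mp y.2))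
  obtain ⟨e, he⟩ := exists_equiv_of_gf
    (fun x : {x // x ∈ FS k 1 (univ : Finset (Fin n))} => wt x.1)
    (fun y : {x // x ∈ PS k 1 (univ : Finset (Fin n))} => (dispk k y.1).toNat) (by
      intro q hq0 hq1
      have h := gF_eq_gP q hq0 hq1 k 1 (univ : Finset (Fin n))
      unfold gF gP at h
      rw [← Finset.sum_coe_sort (FS k 1 univ), ← Finset.sum_coe_sort (PS k 1 univ)] at h
      refine h.trans (Finset.sum_congr rfl fun y _ => ?_)
      rw [← dispk_eq, ← zpow_natCast, Int.toNat_of_nonneg (hnn y)])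
  refine ⟨(forestEquiv n k hk).trans (e.trans (parkingEquiv n k)), fun F => ?_⟩
  have h := he (forestEquiv n k hk F)
  have h2 := hnn (e (forestEquiv n k hk F))
  rw [invk_eq]
  change dispk k (e (forestEquiv n k hk F)).1 = ((wt (forestEquiv n k hk F).1 : ℕ) : ℤ)
  rw [← h, Int.toNat_of_nonneg h2]

end Final

end Material

/-- For all `n, k ≥ 1`, there is a bijection `β : R_n^k → P_n^k` with
`disp_k (β F) = inv_k F` for all `F`; consequently
`∑_{p ∈ P_n^k} q^{disp_k p} = ∑_{F ∈ R_n^k} q^{inv_k F}`. -/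
theorem stmt5 (n k : ℕ) (hn : 1 ≤ n) (hk : 1 ≤ k) :
    ∃ β : KForest n k ≃ {p : Fin n → ℕ // IsParkingFunction k p},
      (∀ F : KForest n k, dispk k (β F).1 = (KForest.invk F : ℤ)) ∧
      ∀ q : ℚ,
        (∑ᶠ p : {p : Fin n → ℕ // IsParkingFunction k p}, q ^ dispk k p.1)
          = ∑ᶠ F : KForest n k, q ^ (KForest.invk F : ℤ) := by
  obtain ⟨β, hβ⟩ := exists_bij n k hk
  refine ⟨β, hβ, fun q => ?_⟩
  symm
  apply finsum_eq_of_bijective β β.bijective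
  intro F
  rw [hβ]
end

section
/- For all n, k ≥ 1, the map L: F_n^k → [0,kn]^n sending a minimal k-factorization f = (τ_1,…,τ_n) with τ_j = (a_j^0 a_j^1 ⋯ a_j^k) to the sequence (a_1^0,…,a_n^0) is a bijection from F_n^k onto the set P_n^k of k-parking functions of length n, and moreover area_k(f) = k·disp_k(L(f)) for all f ∈ F_n^k. -/
namespace KF

open Equiv

/-- A cycle `(c.1, c.2...)` written as a list. -/
def lst (c : ℕ × List ℕ) : List ℕ := c.1 :: c.2

/-- The left-to-right product. -/
def P (l : List (ℕ × List ℕ)) : Perm ℕ := (l.map (fun c => (lst c).formPerm)).reverse.prod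

lemma P_nil : P [] = 1 := by simp [P]

lemma P_append (A B : List (ℕ × List ℕ)) : P (A ++ B) = P B * P A := by
  simp [P]

lemma P_cons (c : ℕ × List ℕ) (B : List (ℕ × List ℕ)) : P (c :: B) = P B * (lst c).formPerm := by
  simp [P]

/-- The long cycle on `{0..M}`. -/
noncomputable def cyc (M : ℕ) : Perm ℕ := Perm.viaEmbedding (finRotate (M+1)) Fin.valEmbedding

lemma cyc_lt {M x : ℕ} (h : x < M) : cyc M x = x + 1 := by
  have := Perm.viaEmbedding_apply (finRotate (M+1)) Fin.valEmbedding ⟨x, by omega⟩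
  rw [finRotate_of_lt h] at this
  simpa [cyc] using this

lemma cyc_self {M : ℕ} : cyc M M = 0 := by
  have := Perm.viaEmbedding_apply (finRotate (M+1)) Fin.valEmbedding ⟨M, by omega⟩
  rw [finRotate_last'] at this
  simpa [cyc] using this

lemma cyc_gt {M x : ℕ} (h : M < x) : cyc M x = x := by
  apply Perm.viaEmbedding_apply_of_notMem
  rintro ⟨y, rfl⟩
  have := y.2
  simp at h
  omega

lemma via_swap {α β : Type*} [DecidableEq α] [DecidableEq β] (e : α ↪ β) (x y : α) :
    Perm.viaEmbeddingHom e (swap x y) = swap (e x) (e y) := by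
  ext z
  rw [Perm.viaEmbeddingHom_apply]
  by_cases hz : z ∈ Set.range e
  · obtain ⟨w, rfl⟩ := hz
    rw [Perm.viaEmbedding_apply]
    rw [e.injective.swap_apply]
  · rw [Perm.viaEmbedding_apply_of_notMem _ _ _ hz, swap_apply_of_ne_of_ne]
    · rintro rfl; exact hz ⟨_, rfl⟩
    · rintro rfl; exact hz ⟨_, rfl⟩

lemma via_formPerm {α β : Type*} [DecidableEq α] [DecidableEq β] (e : α ↪ β) (l : List α) :
    (l.map e).formPerm = Perm.viaEmbeddingHom e l.formPerm := by
  induction l with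
  | nil => simp
  | cons x l ih =>
    cases l with
    | nil => simp
    | cons y l =>
      simp only [List.map_cons, List.formPerm_cons_cons, map_mul, via_swap] at ih ⊢
      rw [ih]

/-- Relabel a cycle. -/
def mapc (e : ℕ → ℕ) (c : ℕ × List ℕ) : ℕ × List ℕ := (e c.1, c.2.map e)

lemma P_map (e : ℕ ↪ ℕ) (l : List (ℕ × List ℕ)) :
    P (l.map (mapc e)) = Perm.viaEmbeddingHom e (P l) := by
  induction l with
  | nil => simp [P_nil]
  | cons c l ih =>
    rw [List.map_cons, P_cons, P_cons, ih, map_mul, ← via_formPerm]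
    rfl

/-- relabelling used after the inserted factor -/
def psi (m k : ℕ) : ℕ ↪ ℕ := ⟨fun x => if x ≤ m then x else x + k, by
  intro x y h; simp only at h; split_ifs at h <;> omega⟩

/-- relabelling used before the inserted factor -/
def phi (m k : ℕ) : ℕ ↪ ℕ := ⟨fun x => if x < m then x else x + k, by
  intro x y h; simp only at h; split_ifs at h <;> omega⟩

lemma psi_apply (m k x : ℕ) : psi m k x = if x ≤ m then x else x + k := rfl
lemma phi_apply (m k x : ℕ) : phi m k x = if x < m then x else x + k := rfl

/-- the inserted factor -/
def tau (m k : ℕ) : Perm ℕ := (lst (m, List.range' (m+1) k)).formPerm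

lemma lst_tau (m k : ℕ) : lst (m, List.range' (m+1) k) = List.range' m (k+1) := by
  simp [lst, List.range'_succ]

lemma tau_mid {m k x : ℕ} (h : m ≤ x) (h2 : x < m + k) : tau m k x = x + 1 := by
  rw [tau, lst_tau]
  have := List.formPerm_apply_lt_getElem (List.range' m (k+1)) List.nodup_range' (x-m)
    (by simp; omega)
  simp only [List.getElem_range', one_mul] at this
  rw [show m + (x - m) = x by omega] at this
  rw [this]; omega

lemma tau_last {m k : ℕ} : tau m k (m + k) = m := by
  rw [tau, lst_tau]
  have := List.formPerm_apply_getElem (List.range' m (k+1)) List.nodup_range' k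
    (by simp)
  simpa using this

lemma tau_out {m k x : ℕ} (h : x < m ∨ m + k < x) : tau m k x = x := by
  rw [tau, lst_tau]
  apply List.formPerm_apply_of_notMem
  simp; omega

lemma tau_phi (m k x : ℕ) : tau m k (phi m k x) = psi m k x := by
  rw [phi_apply, psi_apply]
  rcases lt_trichotomy x m with h | h | h
  · rw [if_pos h, if_pos h.le, tau_out (Or.inl h)]
  · subst h; simp [tau_last]
  · rw [if_neg (by omega), if_neg (by omega), tau_out]; omega

lemma tau_conj (m k : ℕ) (g : Perm ℕ) :
    tau m k * Perm.viaEmbeddingHom (phi m k) g = Perm.viaEmbeddingHom (psi m k) g * tau m k := by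
  ext y
  simp only [Perm.mul_apply, Perm.viaEmbeddingHom_apply]
  by_cases hy : y ∈ Set.range (phi m k)
  · obtain ⟨x, rfl⟩ := hy
    rw [Perm.viaEmbedding_apply, tau_phi, tau_phi, Perm.viaEmbedding_apply]
  · rw [Perm.viaEmbedding_apply_of_notMem _ _ _ hy, Perm.viaEmbedding_apply_of_notMem]
    rintro ⟨x, hx⟩
    rw [← tau_phi] at hx
    exact hy ⟨x, (tau m k).injective hx⟩

lemma cyc_split {m k M : ℕ} (hm : m ≤ M) :
    cyc (M + k) = Perm.viaEmbeddingHom (psi m k) (cyc M) * tau m k := by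
  ext y
  simp only [Perm.mul_apply, Perm.viaEmbeddingHom_apply]
  by_cases hy : y ∈ Set.range (phi m k)
  · obtain ⟨x, rfl⟩ := hy
    rw [tau_phi, Perm.viaEmbedding_apply, phi_apply, psi_apply]
    rcases lt_trichotomy x M with h | h | h
    · rw [cyc_lt h, cyc_lt (by split_ifs <;> omega)]
      split_ifs <;> omega
    · subst h
      rw [if_neg (by omega), cyc_self, cyc_self]; simp
    · rw [if_neg (by omega), cyc_gt (by omega), cyc_gt h, if_neg (by omega)]
  · have h1 : m ≤ y ∧ y < m + k := by
      by_contra hc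
      apply hy
      by_cases h : y < m
      · exact ⟨y, by rw [phi_apply, if_pos h]⟩
      · exact ⟨y - k, by rw [phi_apply, if_neg (by omega)]; omega⟩
    rw [tau_mid h1.1 h1.2, cyc_lt (by omega), Perm.viaEmbedding_apply_of_notMem]
    rintro ⟨x, hx⟩
    rw [psi_apply] at hx
    split_ifs at hx <;> omega

/-- Insert the factor. -/
def expand (m k : ℕ) (A B : List (ℕ × List ℕ)) : List (ℕ × List ℕ) :=
  A.map (mapc (phi m k)) ++ (m, List.range' (m+1) k) :: B.map (mapc (psi m k))

lemma P_expand (m k : ℕ) (A B : List (ℕ × List ℕ)) :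
    P (expand m k A B) = Perm.viaEmbeddingHom (psi m k) (P (A ++ B)) * tau m k := by
  rw [expand, P_append, P_cons, P_map, P_map, mul_assoc]
  change _ * (tau m k * _) = _
  rw [tau_conj, P_append, map_mul, mul_assoc]

lemma P_expand_iff {m k M : ℕ} (hm : m ≤ M) (A B : List (ℕ × List ℕ)) :
    P (expand m k A B) = cyc (M + k) ↔ P (A ++ B) = cyc M := by
  rw [P_expand, cyc_split hm, mul_left_inj]
  exact (Perm.viaEmbeddingHom_injective _).eq_iff

/-- Valid cycles. -/
def Cyc (k M : ℕ) (c : ℕ × List ℕ) : Prop :=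
  c.2.length = k ∧ c.2.Nodup ∧ (∀ x ∈ c.2, c.1 < x ∧ x ≤ M) ∧ c.1 ≤ M

/-- Factorizations in list form. -/
def Good (k n : ℕ) (l : List (ℕ × List ℕ)) : Prop :=
  l.length = n ∧ (∀ c ∈ l, Cyc k (k * n) c) ∧ P l = cyc (k * n)

lemma Cyc.nodup {k M : ℕ} {c : ℕ × List ℕ} (h : Cyc k M c) : (lst c).Nodup := by
  rw [lst, List.nodup_cons]
  exact ⟨fun hc => (h.2.2.1 _ hc).1.ne rfl, h.2.1⟩

lemma Cyc.map {k M : ℕ} {c : ℕ × List ℕ} (e : ℕ ↪ ℕ) (he : StrictMono e)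
    (M' : ℕ) (hM : e M ≤ M') (h : Cyc k M c) : Cyc k M' (mapc e c) := by
  refine ⟨by simpa [mapc] using h.1, h.2.1.map e.injective, ?_, ?_⟩
  · intro x hx
    simp only [mapc, List.mem_map] at hx ⊢
    obtain ⟨y, hy, rfl⟩ := hx
    exact ⟨he (h.2.2.1 y hy).1, (he.monotone (h.2.2.1 y hy).2).trans hM⟩
  · exact (he.monotone h.2.2.2).trans hM

lemma psi_mono (m k : ℕ) : StrictMono (psi m k) := by
  intro x y h; simp only [psi_apply]; split_ifs <;> omega

lemma phi_mono (m k : ℕ) : StrictMono (phi m k) := by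
  intro x y h; simp only [phi_apply]; split_ifs <;> omega

lemma Cyc_tau {m k M : ℕ} (h : m + k ≤ M) : Cyc k M (m, List.range' (m+1) k) := by
  refine ⟨by simp, List.nodup_range', ?_, by simp only; omega⟩
  intro x hx
  simp at hx ⊢
  omega

lemma Good_expand {m k n : ℕ} (hm : m ≤ k * n) {A B : List (ℕ × List ℕ)}
    (h : Good k n (A ++ B)) : Good k (n+1) (expand m k A B) := by
  obtain ⟨h1, h2, h3⟩ := h
  refine ⟨by simp [expand] at h1 ⊢; omega, ?_, ?_⟩
  · intro c hc
    simp only [expand, List.mem_append, List.mem_cons, List.mem_map] at hc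
    rcases hc with ⟨a, ha, rfl⟩ | rfl | ⟨a, ha, rfl⟩
    · exact Cyc.map _ (phi_mono m k) _ (by rw [phi_apply]; split_ifs <;> grind) (h2 a (by simp [ha]))
    · apply Cyc_tau; grind
    · exact Cyc.map _ (psi_mono m k) _ (by rw [psi_apply]; split_ifs <;> grind) (h2 a (by simp [ha]))
  · rw [mul_add, mul_one]
    exact (P_expand_iff hm A B).2 h3

lemma map_fst_phi {m k : ℕ} {A : List (ℕ × List ℕ)} (hA : ∀ c ∈ A, c.1 < m) :
    (A.map (mapc (phi m k))).map Prod.fst = A.map Prod.fst := by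
  rw [List.map_map]
  apply List.map_congr_left
  intro c hc
  simp [mapc, phi_apply, hA c hc]

lemma map_fst_psi {m k : ℕ} {A : List (ℕ × List ℕ)} (hA : ∀ c ∈ A, c.1 ≤ m) :
    (A.map (mapc (psi m k))).map Prod.fst = A.map Prod.fst := by
  rw [List.map_map]
  apply List.map_congr_left
  intro c hc
  simp [mapc, psi_apply, hA c hc]

lemma dimlem (N : ℕ) (E : List (ℕ × ℕ)) (D : List ℕ) (hlen : E.length + D.length = N)
    (hinj : ∀ F : ℕ → ℚ, (∀ x, N ≤ x → F x = 0) → (∀ e ∈ E, F e.1 = F e.2) →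
      (∀ d ∈ D, F d = 0) → ∀ x, F x = 0) (v : ℕ → ℚ) :
    ∃ F : ℕ → ℚ, (∀ x, N ≤ x → F x = 0) ∧ (∀ e ∈ E, F e.1 = F e.2) ∧ ∀ d ∈ D, F d = v d := by
  let ext : (Fin N → ℚ) →ₗ[ℚ] (ℕ → ℚ) :=
    { toFun := fun g x => if h : x < N then g ⟨x, h⟩ else 0
      map_add' := by intro f g; funext x; simp only [Pi.add_apply]; split_ifs <;> simp
      map_smul' := by intro c g; funext x; simp only [Pi.smul_apply]; split_ifs <;> simp }
  have ext0 : ∀ g x, N ≤ x → ext g x = 0 := by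
    intro g x hx
    change (if h : x < N then g ⟨x, h⟩ else 0) = 0
    rw [dif_neg (by omega)]
  let Φ : (Fin N → ℚ) →ₗ[ℚ] (Fin E.length → ℚ) × (Fin D.length → ℚ) :=
    { toFun := fun g => (fun i => ext g (E[i]).1 - ext g (E[i]).2, fun i => ext g (D[i]))
      map_add' := by
        intro f g
        rw [map_add]
        refine Prod.ext ?_ ?_ <;> funext i <;> simp <;> ring
      map_smul' := by
        intro c g
        rw [map_smul]
        refine Prod.ext ?_ ?_ <;> funext i <;> simp <;> ring }
  have hE : ∀ g, (Φ g).1 = 0 → ∀ e ∈ E, ext g e.1 = ext g e.2 := by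
    intro g hg e he
    obtain ⟨i, hi, rfl⟩ := List.mem_iff_getElem.1 he
    exact sub_eq_zero.1 (congrFun hg ⟨i, hi⟩)
  have hΦ : Function.Injective Φ := by
    rw [← LinearMap.ker_eq_bot, LinearMap.ker_eq_bot']
    intro g hg
    have h1 := hinj (ext g) (ext0 g) (hE g (by rw [hg]; rfl)) (by
      intro d hd
      obtain ⟨i, hi, rfl⟩ := List.mem_iff_getElem.1 hd
      exact congrFun (congrArg Prod.snd hg) ⟨i, hi⟩)
    funext x
    have h2 := h1 x
    change (if h : (x : ℕ) < N then g ⟨x, h⟩ else 0) = 0 at h2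
    rw [dif_pos x.2] at h2
    exact h2
  rw [LinearMap.injective_iff_surjective_of_finrank_eq_finrank (by simp [hlen])] at hΦ
  obtain ⟨g, hg⟩ := hΦ (0, fun i => v (D[i]))
  refine ⟨ext g, ext0 g, hE g (by rw [hg]), ?_⟩
  intro d hd
  obtain ⟨i, hi, rfl⟩ := List.mem_iff_getElem.1 hd
  exact congrFun (congrArg Prod.snd hg) ⟨i, hi⟩

lemma const_formPerm {F : ℕ → ℚ} {c : ℕ × List ℕ} (h : ∀ x ∈ c.2, F c.1 = F x) (x : ℕ) :
    F ((lst c).formPerm x) = F x := by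
  have h' : ∀ x ∈ lst c, F x = F c.1 := by
    intro x hx
    rcases List.mem_cons.1 hx with rfl | hx
    · rfl
    · exact (h x hx).symm
  by_cases hx : x ∈ lst c
  · rw [h' _ hx, h' _ (List.formPerm_apply_mem_of_mem hx)]
  · rw [List.formPerm_apply_of_notMem hx]

lemma const_P {F : ℕ → ℚ} {l : List (ℕ × List ℕ)} (h : ∀ c ∈ l, ∀ x ∈ c.2, F c.1 = F x) (x : ℕ) :
    F (P l x) = F x := by
  induction l generalizing x with
  | nil => simp [P_nil]
  | cons c l ih =>
    rw [P_cons, Perm.mul_apply, ih (fun c hc => h c (by simp [hc])),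
      const_formPerm (h c (by simp))]

lemma P_fix {l : List (ℕ × List ℕ)} {x : ℕ} (h : ∀ c ∈ l, x ∉ lst c) : P l x = x := by
  induction l with
  | nil => simp [P_nil]
  | cons c l ih =>
    rw [P_cons, Perm.mul_apply, List.formPerm_apply_of_notMem (h c (by simp)),
      ih (fun c hc => h c (by simp [hc]))]

lemma sum_len {k : ℕ} {β : Type*} (g : ℕ × List ℕ → List β) (l : List (ℕ × List ℕ))
    (h : ∀ c ∈ l, (g c).length = k) :
    (l.flatMap g).length = k * l.length := by
  induction l with
  | nil => simp
  | cons c l ih =>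
    rw [List.flatMap_cons, List.length_append, h c (by simp), ih (fun c hc => h c (by simp [hc]))]
    simp; ring

lemma key {k n m : ℕ} {c : List ℕ} {A B : List (ℕ × List ℕ)}
    (h : Good k (n+1) (A ++ (m, c) :: B)) (hA : ∀ a ∈ A, a.1 < m) (hB : ∀ b ∈ B, b.1 ≤ m)
    (t : Perm ℕ) (ht : t = (lst (m, c)).formPerm) (e : ℕ) (he : t e ∈ c) :
    t e = e + 1 ∧ (∀ b ∈ B, t e ∉ lst b) ∧ (∀ a ∈ A, e ∉ lst a) := by
  obtain ⟨h1, h2, h3⟩ := h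
  set M := k * (n+1) with hM
  have hc : Cyc k M (m, c) := h2 _ (by simp)
  rw [P_append, P_cons, ← ht] at h3
  have hcm : ∀ x ∈ c, m < x ∧ x ≤ M := hc.2.2.1
  have hmM : m ≤ M := hc.2.2.2
  have tout : ∀ x, x ∉ lst (m, c) → t x = x := by
    intro x hx; rw [ht]; exact List.formPerm_apply_of_notMem hx
  have tlow : ∀ x, x < m → t x = x := by
    intro x hx
    apply tout
    intro hx2
    rcases List.mem_cons.1 hx2 with h | h
    · exact hx.ne h
    · have := (hcm x h).1; omega
  let E : List (ℕ × ℕ) := B.flatMap (fun b => b.2.map (fun x => (b.1, x))) ++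
    A.flatMap (fun a => a.2.map (fun x => (t a.1, t x)))
  have hEB : ∀ F : ℕ → ℚ, (∀ e ∈ E, F e.1 = F e.2) → ∀ b ∈ B, ∀ x ∈ b.2, F b.1 = F x := by
    intro F hF b hb x hx
    refine hF (b.1, x) ?_
    simp only [E, List.mem_append, List.mem_flatMap, List.mem_map]
    exact Or.inl ⟨b, hb, x, hx, rfl⟩
  have hEA : ∀ F : ℕ → ℚ, (∀ e ∈ E, F e.1 = F e.2) → ∀ a ∈ A, ∀ x ∈ a.2,
      F (t a.1) = F (t x) := by
    intro F hF a ha x hx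
    refine hF (t a.1, t x) ?_
    simp only [E, List.mem_append, List.mem_flatMap, List.mem_map]
    exact Or.inr ⟨a, ha, x, hx, rfl⟩
  have hcyc : ∀ F : ℕ → ℚ, (∀ e ∈ E, F e.1 = F e.2) → ∀ x, F (cyc M x) = F (t x) := by
    intro F hF x
    rw [← h3, Perm.mul_apply, Perm.mul_apply, const_P (hEB F hF)]
    exact const_P (F := fun x => F (t x)) (hEA F hF) x
  have hlen : E.length + (lst (m, c)).length = M + 1 := by
    simp only [E, List.length_append]
    rw [sum_len (k := k) _ B, sum_len (k := k) _ A]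
    · simp [lst, hc.1.symm] at h1 ⊢
      have h1' : A.length + B.length = n := by omega
      have hck : c.length = k := hc.1
      rw [hM, ← h1', hck]; ring
    · intro a ha; simpa using (h2 a (by simp [ha])).1
    · intro a ha; simpa using (h2 a (by simp [ha])).1
  have hD := dimlem (M+1) E (lst (m, c)) hlen ?_ (fun x => if x = t e then 1 else 0)
  · obtain ⟨F, F0, FE, FD⟩ := hD
    have hte : t e ∈ lst (m, c) := List.mem_cons_of_mem _ he
    have Fd : F (t e) = 1 := by rw [FD _ hte]; simp
    have Fm : F m = 0 := by
      rw [FD m (by simp [lst]), if_neg]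
      intro h; have := (hcm _ he).1; omega
    have Flow : ∀ i, i ≤ m → F (m - i) = 0 := by
      intro i
      induction i with
      | zero => intro _; exact Fm
      | succ i ih =>
        intro hi
        have := hcyc F FE (m - (i+1))
        rw [cyc_lt (by omega), tlow _ (by omega)] at this
        rw [← this, ← ih (by omega)]
        congr 1; omega
    have Flow' : ∀ x, x ≤ m → F x = 0 := by
      intro x hx
      have := Flow (m - x) (by omega)
      rwa [show m - (m - x) = x by omega] at this
    have rB : ∀ b ∈ B, t e ∉ lst b := by
      intro b hb hmem
      have hb0 := Flow' b.1 (hB b hb)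
      rcases List.mem_cons.1 hmem with h | h
      · rw [← h, Fd] at hb0; exact one_ne_zero hb0
      · rw [hEB F FE b hb _ h, Fd] at hb0; exact one_ne_zero hb0
    have rA : ∀ a ∈ A, e ∉ lst a := by
      intro a ha hmem
      have hb0 := Flow' a.1 (hA a ha).le
      rw [← tlow _ (hA a ha)] at hb0
      rcases List.mem_cons.1 hmem with h | h
      · rw [← h, Fd] at hb0; exact one_ne_zero hb0
      · rw [hEA F FE a ha _ h, Fd] at hb0; exact one_ne_zero hb0
    refine ⟨?_, rB, rA⟩
    have hs : cyc M e = t e := by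
      rw [← h3, Perm.mul_apply, Perm.mul_apply, P_fix rA, P_fix rB]
    rw [← hs]
    rcases lt_trichotomy e M with h | h | h
    · exact cyc_lt h
    · exfalso
      rw [show cyc M e = 0 by rw [h, cyc_self]] at hs
      have := (hcm _ he).1; omega
    · exfalso
      rw [cyc_gt h] at hs
      have := (hcm _ he).2; omega
  · intro F F0 FE FD
    have step : ∀ x, F x = 0 → F (cyc M x) = 0 := by
      intro x hx
      rw [hcyc F FE]
      by_cases hxD : x ∈ lst (m, c)
      · apply FD
        rw [ht]
        exact List.formPerm_apply_mem_of_mem hxD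
      · rw [tout x hxD, hx]
    have up : ∀ y, F y = 0 → ∀ i, y + i ≤ M → F (y + i) = 0 := by
      intro y hy i
      induction i with
      | zero => intro _; exact hy
      | succ i ih =>
        intro hi
        have := step _ (ih (by omega))
        rwa [cyc_lt (by omega)] at this
    have hFM : F M = 0 := by
      have := up m (FD m (by simp [lst])) (M - m) (by omega)
      rwa [show m + (M - m) = M by omega] at this
    have hF0 := step _ hFM
    rw [cyc_self] at hF0
    intro x
    by_cases hx : x ≤ M
    · have := up 0 hF0 x (by omega)
      rwa [zero_add] at this
    · exact F0 x (by omega)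

lemma contract {k n m : ℕ} {c : List ℕ} {A B : List (ℕ × List ℕ)}
    (h : Good k (n+1) (A ++ (m, c) :: B)) (hA : ∀ a ∈ A, a.1 < m) (hB : ∀ b ∈ B, b.1 ≤ m) :
    m ≤ k * n ∧ ∃ A' B', A'.length = A.length ∧ Good k n (A' ++ B') ∧
      A ++ (m, c) :: B = expand m k A' B' ∧
      A'.map Prod.fst = A.map Prod.fst ∧ B'.map Prod.fst = B.map Prod.fst := by
  have hk := key h hA hB _ rfl
  have hc : Cyc k (k*(n+1)) (m, c) := h.2.1 _ (by simp)
  have hck : c.length = k := hc.1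
  have hnd := hc.nodup
  -- shape of the list
  have hget : ∀ i (hi : i < (lst (m, c)).length), (lst (m, c))[i] = m + i := by
    intro i
    induction i with
    | zero => intro _; simp [lst]
    | succ i ih =>
      intro hi
      have h1 := List.formPerm_apply_lt_getElem (lst (m, c)) hnd i hi
      have h2 := hk (lst (m, c))[i] (by rw [h1]; simp [lst])
      rw [← h1, h2.1, ih (by omega)]; omega
  have hlst : lst (m, c) = List.range' m (k+1) := by
    apply List.ext_getElem
    · simp [lst, hck]
    · intro i h1 h2
      rw [hget]; simp
  have hcr : c = List.range' (m+1) k := by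
    have : lst (m, c) = lst (m, List.range' (m+1) k) := by rw [hlst, lst_tau]
    simpa [lst] using this
  subst hcr
  have hmk : m + k ≤ k * (n+1) := by
    rcases Nat.eq_zero_or_pos k with h0 | h0
    · have : m ≤ _ := hc.2.2.2
      subst h0; simpa using this
    · exact (hc.2.2.1 (m+k) (by simp; omega)).2
  have hm : m ≤ k * n := by rw [mul_add] at hmk; omega
  have hmid : ∀ x, m ≤ x → x < m + k → (∀ b ∈ B, x + 1 ∉ lst b) ∧ (∀ a ∈ A, x ∉ lst a) := by
    intro x h1 h2
    have h3 : tau m k x = x + 1 := tau_mid h1 h2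
    have h4 := hk x (by
      change tau m k x ∈ _
      rw [h3]; simp; omega)
    change tau m k x = _ ∧ (∀ b ∈ B, tau m k x ∉ _) ∧ _ at h4
    rw [h3] at h4
    exact h4.2
  -- inverse maps
  let ip : ℕ → ℕ := fun x => if x ≤ m then x else x - k
  have hBB : ∀ b ∈ B, ∀ x ∈ lst b, psi m k (ip x) = x := by
    intro b hb x hx
    have h1 : ¬ (m < x ∧ x ≤ m + k) := by
      intro h2
      have := (hmid (x-1) (by omega) (by omega)).1 b hb
      rw [show x - 1 + 1 = x by omega] at this
      exact this hx
    simp only [ip, psi_apply]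
    split_ifs <;> omega
  have hAA : ∀ a ∈ A, ∀ x ∈ lst a, phi m k (ip x) = x := by
    intro a ha x hx
    have h1 : ¬ (m ≤ x ∧ x < m + k) := by
      intro h2
      exact (hmid x h2.1 h2.2).2 a ha hx
    simp only [ip, phi_apply]
    split_ifs <;> omega
  have hpull : ∀ (e : ℕ ↪ ℕ) (_ : StrictMono e) (L : List (ℕ × List ℕ)),
      (∀ a ∈ L, ∀ x ∈ lst a, e (ip x) = x) → (L.map (mapc ip)).map (mapc e) = L := by
    intro e he L hL
    rw [List.map_map]
    conv_rhs => rw [← List.map_id L]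
    apply List.map_congr_left
    intro a ha
    have h1 := hL a ha
    simp only [Function.comp, mapc, id, List.map_map]
    refine Prod.ext (h1 _ (by simp [lst])) ?_
    simp only
    conv_rhs => rw [← List.map_id a.2]
    apply List.map_congr_left
    intro x hx
    exact h1 x (by simp [lst, hx])
  have hA' := hpull (phi m k) (phi_mono m k) A hAA
  have hB' := hpull (psi m k) (psi_mono m k) B hBB
  have hexp : A ++ (m, List.range' (m+1) k) :: B =
      expand m k (A.map (mapc ip)) (B.map (mapc ip)) := by
    rw [expand, hA', hB']
  have hcycpull : ∀ (e : ℕ ↪ ℕ) (_ : StrictMono e) (_ : ∀ y, e y ≤ k * (n+1) → y ≤ k * n)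
      (a : ℕ × List ℕ),
      (∀ x ∈ lst a, e (ip x) = x) → Cyc k (k*(n+1)) a → Cyc k (k*n) (mapc ip a) := by
    intro e he hM a h1 h2
    have hle : ∀ x ∈ lst a, x ≤ k*(n+1) → ip x ≤ k * n := by
      intro x hx hx2
      exact hM _ (by rw [h1 x hx]; exact hx2)
    refine ⟨by simpa [mapc] using h2.1, ?_, ?_, hle _ (by simp [lst]) h2.2.2.2⟩
    · refine List.Nodup.map_on ?_ h2.2.1
      intro x hx y hy hxy
      rw [← h1 x (by simp [lst, hx]), ← h1 y (by simp [lst, hy]), hxy]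
    · intro x hx
      simp only [mapc, List.mem_map] at hx ⊢
      obtain ⟨y, hy, rfl⟩ := hx
      have hy' : y ∈ lst a := by simp [lst, hy]
      refine ⟨?_, hle y hy' (h2.2.2.1 y hy).2⟩
      rw [← he.lt_iff_lt, h1 y hy', h1 a.1 (by simp [lst])]
      exact (h2.2.2.1 y hy).1
  refine ⟨hm, A.map (mapc ip), B.map (mapc ip), by simp, ⟨?_, ?_, ?_⟩, hexp, ?_, ?_⟩
  · have := h.1
    simp at this ⊢; omega
  · intro x hx
    rw [List.mem_append, List.mem_map, List.mem_map] at hx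
    rcases hx with ⟨a, ha, rfl⟩ | ⟨a, ha, rfl⟩
    · apply hcycpull _ (phi_mono m k) _ a (hAA a ha) (h.2.1 a (by simp [ha]))
      intro y hy
      rw [phi_apply, mul_add] at hy
      split_ifs at hy <;> omega
    · apply hcycpull _ (psi_mono m k) _ a (hBB a ha) (h.2.1 a (by simp [ha]))
      intro y hy
      rw [psi_apply, mul_add] at hy
      split_ifs at hy <;> omega
  · have h3 := h.2.2
    rw [hexp, mul_add, mul_one, P_expand_iff hm] at h3
    exact h3
  · rw [List.map_map]
    apply List.map_congr_left
    intro a ha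
    simp [mapc, ip, (hA a ha).le]
  · rw [List.map_map]
    apply List.map_congr_left
    intro a ha
    simp [mapc, ip, hB a ha]

lemma exists_first_max (p : List ℕ) (hp : p ≠ []) :
    ∃ A m B, p = A ++ m :: B ∧ (∀ a ∈ A, a < m) ∧ (∀ b ∈ B, b ≤ m) := by
  induction p with
  | nil => exact absurd rfl hp
  | cons x p ih =>
    by_cases h0 : p = []
    · subst h0
      exact ⟨[], x, [], by simp, by simp, by simp⟩
    · obtain ⟨A, m, B, rfl, hA, hB⟩ := ih h0
      by_cases hx : x < m
      · refine ⟨x :: A, m, B, by simp, ?_, hB⟩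
        intro a ha
        rcases List.mem_cons.1 ha with rfl | ha
        · exact hx
        · exact hA a ha
      · refine ⟨[], x, A ++ m :: B, by simp, by simp, ?_⟩
        intro b hb
        rcases List.mem_append.1 hb with hb | hb
        · have := hA b hb; omega
        · rcases List.mem_cons.1 hb with rfl | hb
          · omega
          · have := hB b hb; omega

lemma split_fst {l : List (ℕ × List ℕ)} {A B : List ℕ} {m : ℕ}
    (h : l.map Prod.fst = A ++ m :: B) :
    ∃ A' c B', l = A' ++ (m, c) :: B' ∧ A'.map Prod.fst = A ∧ B'.map Prod.fst = B := by
  obtain ⟨l₁, l₂, rfl, h1, h2⟩ := List.map_eq_append_iff.1 h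
  obtain ⟨c, l₃, rfl, h3, h4⟩ := List.map_eq_cons_iff.1 h2
  refine ⟨l₁, c.2, l₃, ?_, h1, h4⟩
  rw [← h3]

/-- Parking functions, list form. -/
def Park (k n : ℕ) (p : List ℕ) : Prop :=
  p.length = n ∧ ∀ t, t ≤ k * n → t ≤ k * p.countP (fun x => decide (x < t))

lemma forall_fst {A : List (ℕ × List ℕ)} {A₀ : List ℕ} (h : A.map Prod.fst = A₀) {Q : ℕ → Prop}
    (hA : ∀ a ∈ A₀, Q a) : ∀ a ∈ A, Q a.1 := by
  subst h
  intro a ha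
  exact hA _ (List.mem_map_of_mem ha)

lemma T1 (k n : ℕ) : ∀ l l', Good k n l → Good k n l' → l.map Prod.fst = l'.map Prod.fst →
    l = l' := by
  induction n with
  | zero =>
    intro l l' h h' _
    rw [List.length_eq_zero_iff.1 h.1, List.length_eq_zero_iff.1 h'.1]
  | succ n ih =>
    intro l l' h h' hl
    obtain ⟨A, m, B, hp, hA, hB⟩ := exists_first_max (l.map Prod.fst) (by
      intro h0
      have := congrArg List.length h0
      simp [h.1] at this)
    obtain ⟨A1, c1, B1, rfl, hA1, hB1⟩ := split_fst hp
    obtain ⟨A2, c2, B2, rfl, hA2, hB2⟩ := split_fst (hl.symm.trans hp)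
    obtain ⟨-, A1', B1', e1, g1, x1, a1, b1⟩ := contract h (forall_fst hA1 hA) (forall_fst hB1 hB)
    obtain ⟨-, A2', B2', e2, g2, x2, a2, b2⟩ := contract h' (forall_fst hA2 hA) (forall_fst hB2 hB)
    have := ih _ _ g1 g2 (by simp [a1, a2, b1, b2, hA1, hA2, hB1, hB2])
    have hlen : A1'.length = A2'.length := by
      rw [e1, e2]
      have := congrArg List.length (hA1.trans hA2.symm)
      simpa using this
    obtain ⟨rfl, rfl⟩ := List.append_inj this hlen
    rw [x1, x2]

lemma T2 (k n : ℕ) : ∀ l, Good k n l → Park k n (l.map Prod.fst) := by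
  induction n with
  | zero =>
    intro l h
    rw [List.length_eq_zero_iff.1 h.1]
    exact ⟨rfl, by intro t ht; simpa using ht⟩
  | succ n ih =>
    intro l h
    obtain ⟨A, m, B, hp, hA, hB⟩ := exists_first_max (l.map Prod.fst) (by
      intro h0
      have := congrArg List.length h0
      simp [h.1] at this)
    obtain ⟨A1, c1, B1, rfl, hA1, hB1⟩ := split_fst hp
    obtain ⟨hm, A1', B1', e1, g1, x1, a1, b1⟩ :=
      contract h (forall_fst hA1 hA) (forall_fst hB1 hB)
    have h1 := ih _ g1
    refine ⟨by simpa using h.1, ?_⟩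
    intro t ht
    by_cases htn : t ≤ k * n
    · refine (h1.2 t htn).trans ?_
      apply Nat.mul_le_mul_left
      simp only [List.map_append, List.map_cons, a1, b1, List.countP_append, List.countP_cons]
      omega
    · have : List.countP (fun x => decide (x < t))
          (List.map Prod.fst (A1 ++ (m, c1) :: B1)) = n + 1 := by
        rw [← h.1, ← List.length_map (f := Prod.fst), List.countP_eq_length, hp]
        intro a ha
        rw [List.mem_append, List.mem_cons] at ha
        rw [decide_eq_true_eq]
        rcases ha with ha | rfl | ha
        · have := hA a ha; omega
        · omega
        · have := hB a ha; omega
      rw [this]; exact ht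

lemma T3 (k n : ℕ) (hk : 1 ≤ k) : ∀ p, Park k n p → ∃ l, Good k n l ∧ l.map Prod.fst = p := by
  induction n with
  | zero =>
    intro p h
    rw [List.length_eq_zero_iff.1 h.1]
    refine ⟨[], ⟨rfl, by simp, ?_⟩, rfl⟩
    rw [P_nil, mul_zero]
    ext x
    rcases Nat.eq_zero_or_pos x with rfl | hx
    · rw [cyc_self]; rfl
    · rw [cyc_gt hx]; rfl
  | succ n ih =>
    intro p h
    obtain ⟨A, m, B, rfl, hA, hB⟩ := exists_first_max p (by
      intro h0
      have := congrArg List.length h0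
      simp [h.1] at this)
    have hlen : A.length + B.length = n := by have := h.1; simp at this; omega
    have hm : m ≤ k * n := by
      by_contra hc
      have h1 := h.2 (k*n+1) (by rw [mul_add]; omega)
      have h2 : List.countP (fun x => decide (x < k*n+1)) (A ++ m :: B) ≤ n := by
        rw [List.countP_append, List.countP_cons_of_neg (by simp; omega), ← hlen]
        exact Nat.add_le_add List.countP_le_length List.countP_le_length
      have := Nat.mul_le_mul_left k h2
      omega
    obtain ⟨l, hl, hlp⟩ := ih (A ++ B) ⟨by simpa using hlen, by
      intro t ht
      by_cases hmt : m < t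
      · have : List.countP (fun x => decide (x < t)) (A ++ B) = n := by
          rw [← hlen, ← List.length_append, List.countP_eq_length]
          intro a ha
          rw [List.mem_append] at ha
          rw [decide_eq_true_eq]
          rcases ha with ha | ha
          · have := hA a ha; omega
          · have := hB a ha; omega
        rw [this]; exact ht
      · have h1 := h.2 t (ht.trans (Nat.mul_le_mul_left k (by omega)))
        rw [List.countP_append, List.countP_cons_of_neg (by simp; omega)] at h1
        rwa [List.countP_append]⟩
    obtain ⟨A', B', rfl, hA', hB'⟩ := List.map_eq_append_iff.1 hlp
    refine ⟨expand m k A' B', Good_expand hm hl, ?_⟩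
    rw [expand, List.map_append, List.map_cons, map_fst_phi (forall_fst hA' hA),
      map_fst_psi (forall_fst hB' hB), hA', hB']

lemma countP_ofFn {n : ℕ} (p : Fin n → ℕ) (t : ℕ) :
    (List.ofFn p).countP (fun x => decide (x < t)) =
      (Finset.univ.filter (fun i => p i < t)).card := by
  induction n with
  | zero => simp
  | succ n ih =>
    rw [List.ofFn_succ, List.countP_cons, ih, Fin.card_filter_univ_succ]
    simp only [decide_eq_true_eq]
    split_ifs <;> rfl

lemma park_iff {k n : ℕ} (hk : 1 ≤ k) (p : Fin n → ℕ) :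
    IsParkingFunction k p ↔ Park k n (List.ofFn p) := by
  have hcount : ∀ t, (List.ofFn p).countP (fun x => decide (x < t)) =
      (Finset.univ.filter (fun i => p i < t)).card := by
    intro t
    exact countP_ofFn p t
  have hperm : ∀ t, (Finset.univ.filter (fun i => p i < t)).card =
      (Finset.univ.filter (fun i => (p ∘ Tuple.sort p) i < t)).card := by
    intro t
    rw [← Finset.card_map (Tuple.sort p).toEmbedding
      (s := Finset.univ.filter (fun i => (p ∘ Tuple.sort p) i < t))]
    congr 1
    ext i
    simp
  have hmono := Tuple.monotone_sort p
  have hlt : ∀ (j : Fin n) t, (j : ℕ) < (Finset.univ.filter (fun i => p i < t)).card ↔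
      p (Tuple.sort p j) < t := by
    intro j t
    rw [hperm]
    exact Tuple.lt_card_lt_iff_apply_lt_of_monotone hmono
  simp only [Park, hcount, List.length_ofFn, true_and]
  have hle : ∀ t, (Finset.univ.filter (fun i => p i < t)).card ≤ n := by
    intro t
    exact (Finset.card_le_univ _).trans (by simp)
  constructor
  · intro h t ht
    rcases eq_or_lt_of_le (hle t) with h1 | h1
    · rw [h1]; exact ht
    · have h2 := h ⟨_, h1⟩
      have h3 := (hlt ⟨_, h1⟩ t).not.1 (by simp)
      simp only at h2
      omega
  · intro h i
    have h1 : p (Tuple.sort p i) < k * n := by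
      rw [← hlt]
      have := Nat.le_of_mul_le_mul_left (h (k*n) le_rfl) hk
      omega
    refine (h _ h1.le).trans (Nat.mul_le_mul_left k ?_)
    have := (hlt i (p (Tuple.sort p i))).not.2 (by simp)
    omega

/-- The list form of a minimal factorization. -/
def toL {n k : ℕ} (a : Fin n → Fin (k+1) → Fin (k*n+1)) : List (ℕ × List ℕ) :=
  List.ofFn (fun j => ((a j 0 : ℕ), List.ofFn (fun i : Fin k => (a j i.succ : ℕ))))

lemma P_toL {n k : ℕ} (a : Fin n → Fin (k+1) → Fin (k*n+1)) :
    P (toL a) = Perm.viaEmbeddingHom Fin.valEmbedding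
      (List.ofFn (fun j => (List.ofFn (a j)).formPerm)).reverse.prod := by
  rw [P, map_list_prod, List.map_reverse, toL, List.map_ofFn, List.map_ofFn]
  congr 3
  funext j
  simp only [Function.comp]
  rw [← via_formPerm, List.map_ofFn, List.ofFn_succ]
  rfl

lemma P_toL_iff {n k : ℕ} (a : Fin n → Fin (k+1) → Fin (k*n+1)) :
    P (toL a) = cyc (k*n) ↔
      (List.ofFn (fun j => (List.ofFn (a j)).formPerm)).reverse.prod = finRotate (k*n+1) := by
  rw [P_toL, cyc, ← Perm.viaEmbeddingHom_apply]
  exact (Perm.viaEmbeddingHom_injective _).eq_iff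

lemma toL_fst {n k : ℕ} (a : Fin n → Fin (k+1) → Fin (k*n+1)) :
    (toL a).map Prod.fst = List.ofFn (fun j => (a j 0 : ℕ)) := by
  rw [toL, List.map_ofFn]; rfl

lemma Good_toL {n k : ℕ} (f : MinKFact n k) : Good k n (toL f.a) := by
  refine ⟨by simp [toL], ?_, (P_toL_iff f.a).2 f.prod_eq⟩
  intro c hc
  rw [toL, List.mem_ofFn] at hc
  obtain ⟨j, rfl⟩ := hc
  refine ⟨by simp, ?_, ?_, ?_⟩
  · rw [List.nodup_ofFn]
    intro x y hxy
    exact Fin.succ_injective _ (f.inj j (Fin.ext hxy))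
  · intro x hx
    rw [List.mem_ofFn] at hx
    obtain ⟨i, rfl⟩ := hx
    refine ⟨?_, ?_⟩
    · have h1 := f.min_first j i.succ
      have h2 : f.a j 0 ≠ f.a j i.succ := fun h => (Fin.succ_ne_zero i) (f.inj j h).symm
      exact Fin.lt_def.1 (lt_of_le_of_ne h1 h2)
    · have := (f.a j i.succ).2
      omega
  · have := (f.a j 0).2
    simp only
    omega

lemma toL_inj {n k : ℕ} {a b : Fin n → Fin (k+1) → Fin (k*n+1)} (h : toL a = toL b) : a = b := by
  have h1 := List.ofFn_injective h
  funext j i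
  have h2 := congrFun h1 j
  rw [Prod.mk.injEq] at h2
  refine Fin.cases ?_ (fun i => ?_) i
  · exact Fin.ext h2.1
  · exact Fin.ext (congrFun (List.ofFn_injective h2.2) i)

lemma exists_of_Good {n k : ℕ} {l : List (ℕ × List ℕ)} (h : Good k n l) :
    ∃ f : MinKFact n k, toL f.a = l := by
  obtain ⟨h1, h2, h3⟩ := h
  subst h1
  have hc : ∀ j : Fin l.length, Cyc k (k * l.length) l[j] := fun j => h2 _ (List.getElem_mem _)
  have hlen : ∀ j : Fin l.length, (lst l[j]).length = k + 1 := by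
    intro j; simpa [lst] using (hc j).1
  have hmem : ∀ (j : Fin l.length) x, x ∈ lst l[j] → l[j].1 ≤ x ∧ x ≤ k * l.length := by
    intro j x hx
    rcases List.mem_cons.1 hx with rfl | hx
    · exact ⟨le_rfl, (hc j).2.2.2⟩
    · exact ⟨((hc j).2.2.1 x hx).1.le, ((hc j).2.2.1 x hx).2⟩
  let a : Fin l.length → Fin (k+1) → Fin (k * l.length + 1) := fun j i =>
    ⟨(lst l[j])[(i : ℕ)]'(by rw [hlen]; exact i.2),
      Nat.lt_succ_of_le (hmem j _ (List.getElem_mem _)).2⟩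
  have ha : toL a = l := by
    apply List.ext_getElem
    · simp [toL]
    · intro j hj1 hj2
      simp only [toL, List.getElem_ofFn]
      refine Prod.ext rfl ?_
      apply List.ext_getElem
      · simpa using (hc ⟨j, hj2⟩).1.symm
      · intro i hi1 hi2
        simp [a, lst]
  refine ⟨⟨a, ?_, ?_, ?_⟩, ha⟩
  · intro j x y hxy
    have h4 := congrArg Fin.val hxy
    exact Fin.ext ((hc j).nodup.getElem_inj_iff.1 h4)
  · intro j i
    exact (hmem j _ (List.getElem_mem _)).1
  · rw [← P_toL_iff, ha]; exact h3

lemma area_eq (n k : ℕ) :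
    ((k*n).choose 2 : ℤ) - n * (k.choose 2 : ℤ) = k * (k * (n.choose 2 : ℤ)) := by
  have h : ∀ x : ℕ, ((x.choose 2 : ℕ) : ℚ) = x * (x - 1) / 2 := fun x => Nat.cast_choose_two ℚ x
  have : (((k*n).choose 2 : ℕ) : ℚ) - n * (k.choose 2 : ℕ) = k * (k * (n.choose 2 : ℕ)) := by
    rw [h, h, h]; push_cast; ring
  exact_mod_cast this

end KF

/-- For all `n, k ≥ 1`, the map `L : F_n^k → ℕ^n` sending a minimal
`k`-factorization `f` to `(a_1^0, …, a_n^0)` is a bijection from `F_n^k` onto the set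
`P_n^k` of `k`-parking functions of length `n`, and `area_k f = k · disp_k (L f)`. -/
theorem stmt6 (n k : ℕ) (hn : 1 ≤ n) (hk : 1 ≤ k) :
    Function.Injective (fun (f : MinKFact n k) (j : Fin n) => (f.a j 0 : ℕ)) ∧
    Set.range (fun (f : MinKFact n k) (j : Fin n) => (f.a j 0 : ℕ))
      = {p : Fin n → ℕ | IsParkingFunction k p} ∧
    ∀ f : MinKFact n k,
      MinKFact.areak f = k * dispk k (fun j : Fin n => (f.a j 0 : ℕ)) := by
  have hfst : ∀ f : MinKFact n k, (KF.toL f.a).map Prod.fst =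
      List.ofFn (fun j => (f.a j 0 : ℕ)) := fun f => KF.toL_fst f.a
  refine ⟨?_, ?_, ?_⟩
  · intro f g hfg
    have h := KF.T1 k n _ _ (KF.Good_toL f) (KF.Good_toL g) (by
      rw [hfst, hfst]; exact congrArg List.ofFn hfg)
    have h2 := KF.toL_inj h
    cases f; cases g
    simp only at h2
    subst h2
    rfl
  · ext p
    simp only [Set.mem_range, Set.mem_ofPred_eq]
    rw [KF.park_iff hk]
    constructor
    · rintro ⟨f, rfl⟩
      rw [← hfst]
      exact KF.T2 k n _ (KF.Good_toL f)
    · intro hp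
      obtain ⟨l, hl, hlp⟩ := KF.T3 k n hk _ hp
      obtain ⟨f, rfl⟩ := KF.exists_of_Good hl
      refine ⟨f, ?_⟩
      rw [hfst] at hlp
      exact List.ofFn_injective hlp
  · intro f
    rw [MinKFact.areak, dispk, KF.area_eq]
    ring
end

section
/- For every n ≥ 1, there exists a bijection φ: F_n → R_n such that, writing F = φ(f) for f = ((a_1 b_1),…,(a_n b_n)) ∈ F_n: area(f) = maj(F), coarea(f) = comaj(F), and the hook length at vertex i in F satisfies h(i) = b_i − a_i for every i ∈ {1,…,n}. -/
namespace RootedForest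

variable {n : ℕ} (F : RootedForest (Fin n))

/-- Induction from a parent to its children. -/
lemma wf_parent : WellFounded (fun i j : Fin n => F.parent j = some i) := by
  have h1 : WellFounded (fun i j : Fin n => F.Desc i j) := by
    have : IsTrans (Fin n) (fun i j : Fin n => F.Desc i j) :=
      ⟨fun a b c hab hbc => Relation.TransGen.trans hbc hab⟩
    have : Std.Irrefl (fun i j : Fin n => F.Desc i j) := ⟨fun a h => F.acyclic a h⟩
    exact Finite.wellFounded_of_trans_of_irrefl _
  refine Subrelation.wf ?_ h1
  intro i j h
  exact Relation.TransGen.single h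

/-- Induction from the children to the parent. -/
lemma wf_child : WellFounded (fun i j : Fin n => F.parent i = some j) := by
  have h1 : WellFounded (fun i j : Fin n => F.Desc j i) := by
    have : IsTrans (Fin n) (fun i j : Fin n => F.Desc j i) :=
      ⟨fun a b c hab hbc => Relation.TransGen.trans hab hbc⟩
    have : Std.Irrefl (fun i j : Fin n => F.Desc j i) := ⟨fun a h => F.acyclic a h⟩
    exact Finite.wellFounded_of_trans_of_irrefl _
  refine Subrelation.wf ?_ h1
  intro i j h
  exact Relation.TransGen.single h

lemma mem_hook_iff (u v : Fin n) :
    v ∈ F.hook u ↔ Relation.ReflTransGen (fun a b => F.parent a = some b) v u := by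
  rw [Relation.reflTransGen_iff_eq_or_transGen]
  simp only [hook, Desc, Set.mem_ofPred_eq, eq_comm]

lemma hook_disj {w : Option (Fin n)} {c d v : Fin n} (hc : F.parent c = w) (hd : F.parent d = w)
    (hvc : v ∈ F.hook c) (hvd : v ∈ F.hook d) : c = d := by
  have key : ∀ c d : Fin n, F.parent c = w → F.parent d = w →
      Relation.ReflTransGen (fun a b => F.parent a = some b) c d → c = d := by
    intro c d hc hd h
    rcases Relation.ReflTransGen.cases_head h with h | ⟨x, hx, hxd⟩
    · exact h
    · exfalso
      have : F.parent d = some x := by rw [hd, ← hc, hx]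
      exact F.acyclic x (Relation.TransGen.tail' hxd this)
  rw [mem_hook_iff] at hvc hvd
  have U : Relator.RightUnique (fun a b => F.parent a = some b) := by
    intro a b c hb hc
    rw [hb] at hc
    exact Option.some.inj hc
  rcases Relation.ReflTransGen.total_of_right_unique U hvc hvd with h | h
  · exact key _ _ hc hd h
  · exact (key _ _ hd hc h).symm

lemma sum_h_eq (w : Option (Fin n)) :
    ∑ j ∈ Finset.univ.filter (fun j => F.parent j = w), F.h j
      = {v : Fin n | ∃ c, F.parent c = w ∧ v ∈ F.hook c}.ncard := by
  classical
  have : {v : Fin n | ∃ c, F.parent c = w ∧ v ∈ F.hook c}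
      = ((Finset.univ.filter (fun j => F.parent j = w)).biUnion
          (fun j => (F.hook j).toFinite.toFinset) : Finset (Fin n)) := by
    ext v; simp
  rw [this, Set.ncard_coe_finset, Finset.card_biUnion]
  · refine Finset.sum_congr rfl fun j _ => ?_
    rw [h, Set.ncard_eq_toFinset_card]
  · intro c hc d hd hcd
    rw [Function.onFun, Finset.disjoint_left]
    intro v hv hv'
    simp only [Set.Finite.mem_toFinset, Finset.coe_filter, Finset.mem_univ, true_and] at hv hv'
    have hc : F.parent c = w := by simpa using hc
    have hd : F.parent d = w := by simpa using hd
    exact hcd (F.hook_disj hc hd hv hv')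

lemma sum_kids_some (i : Fin n) :
    ∑ j ∈ Finset.univ.filter (fun j => F.parent j = some i), F.h j + 1 = F.h i := by
  rw [sum_h_eq, h]
  have : F.hook i = insert i {v : Fin n | ∃ c, F.parent c = some i ∧ v ∈ F.hook c} := by
    ext v
    rw [mem_hook_iff, Set.mem_insert_iff, Set.mem_ofPred_eq]
    simp only [mem_hook_iff]
    constructor
    · intro h
      rcases Relation.ReflTransGen.cases_tail h with h | ⟨x, hx, hxd⟩
      · exact Or.inl h.symm
      · exact Or.inr ⟨x, hxd, hx⟩
    · rintro (rfl | ⟨c, hc, hv⟩)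
      · exact Relation.ReflTransGen.refl
      · exact hv.tail hc
  rw [this, Set.ncard_insert_of_notMem]
  rintro ⟨c, hc, hv⟩
  rw [mem_hook_iff] at hv
  exact F.acyclic i (Relation.TransGen.tail' hv hc)

lemma sum_kids_none :
    ∑ j ∈ Finset.univ.filter (fun j => F.parent j = none), F.h j = n := by
  rw [sum_h_eq]
  have : {v : Fin n | ∃ c, F.parent c = none ∧ v ∈ F.hook c} = Set.univ := by
    ext v
    simp only [Set.mem_ofPred_eq, Set.mem_univ, iff_true, mem_hook_iff]
    induction v using F.wf_parent.induction with
    | _ v ih =>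
      cases hp : F.parent v with
      | none => exact ⟨v, hp, Relation.ReflTransGen.refl⟩
      | some x =>
        obtain ⟨c, hc, hx⟩ := ih x hp
        exact ⟨c, hc, Relation.ReflTransGen.head hp hx⟩
  rw [this, Set.ncard_univ, Nat.card_eq_fintype_card, Fintype.card_fin]

lemma h_pos (i : Fin n) : 0 < F.h i := by
  have := F.sum_kids_some i
  omega

lemma hL_add_hR (i : Fin n) : F.hL i + F.hR i + 1 = F.h i := by
  rw [← F.sum_kids_some i, hL, hR]
  congr 1
  rw [← Finset.sum_union]
  · refine Finset.sum_congr ?_ fun _ _ => rfl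
    ext v
    simp only [Finset.mem_union, Finset.mem_filter, Finset.mem_univ, true_and]
    constructor
    · rintro (h | h) <;> exact h.1
    · intro h
      have : v ≠ i := by
        rintro rfl
        exact F.acyclic v (Relation.TransGen.single h)
      rcases lt_or_gt_of_ne this with h' | h'
      · exact Or.inl ⟨h, h'⟩
      · exact Or.inr ⟨h, h'⟩
  · rw [Finset.disjoint_left]
    intro v hv hv'
    simp only [Finset.mem_filter, Finset.mem_univ, true_and] at hv hv'
    exact absurd hv.2 (not_lt.2 hv'.2.le)

end RootedForest

namespace MinFactAux

open Finset

variable {n : ℕ}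

/-- Displacement up to time `t` of the trajectory with index `w`. -/
def shift (p : Fin n → Option (Fin n)) (L : Fin n → ℤ) (w : Option (Fin n)) (t : ℕ) : ℤ :=
  ∑ j : Fin n, if (j : ℕ) < t then
    L j * ((if w = some j then 1 else 0) - (if p j = w then 1 else 0)) else 0

lemma shift_zero (p : Fin n → Option (Fin n)) (L : Fin n → ℤ) (w : Option (Fin n)) :
    shift p L w 0 = 0 := by simp [shift]

lemma sum_ite_succ (g : Fin n → ℤ) (t : Fin n) :
    (∑ j : Fin n, if (j : ℕ) < (t : ℕ) + 1 then g j else 0)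
      = (∑ j : Fin n, if (j : ℕ) < (t : ℕ) then g j else 0) + g t := by
  have : g t = ∑ j : Fin n, if j = t then g j else 0 := by simp
  rw [this, ← sum_add_distrib]
  refine sum_congr rfl fun j _ => ?_
  by_cases h : j = t
  · subst h; simp
  · have h' : (j : ℕ) ≠ t := fun e => h (Fin.ext e)
    by_cases h2 : (j : ℕ) < t
    · rw [if_pos (by omega), if_pos h2, if_neg h, add_zero]
    · rw [if_neg (by omega), if_neg h2, if_neg h, add_zero]

lemma shift_succ (p : Fin n → Option (Fin n)) (L : Fin n → ℤ) (w : Option (Fin n)) (t : Fin n) :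
    shift p L w (t + 1) = shift p L w t +
      L t * ((if w = some t then 1 else 0) - (if p t = w then 1 else 0)) :=
  sum_ite_succ _ t

lemma shift_none_end (p : Fin n → Option (Fin n)) (L : Fin n → ℤ) :
    shift p L none n = - ∑ j ∈ univ.filter (fun j => p j = none), L j := by
  rw [shift, sum_filter, ← sum_neg_distrib]
  refine sum_congr rfl fun j _ => ?_
  rw [if_pos j.2]
  split_ifs <;> simp_all

lemma shift_some_end (p : Fin n → Option (Fin n)) (L : Fin n → ℤ) (i : Fin n) :
    shift p L (some i) n = L i - ∑ j ∈ univ.filter (fun j => p j = some i), L j := by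
  have : L i = ∑ j : Fin n, if i = j then L j else 0 := by simp
  rw [this, shift, sum_filter, ← sum_sub_distrib]
  refine sum_congr rfl fun j _ => ?_
  rw [if_pos j.2]
  simp only [Option.some.injEq]
  split_ifs <;> simp

lemma shift_some_self (p : Fin n → Option (Fin n)) (L : Fin n → ℤ) (i : Fin n) :
    shift p L (some i) i = - ∑ j ∈ univ.filter (fun j => p j = some i ∧ j < i), L j := by
  rw [shift, sum_filter, ← sum_neg_distrib]
  refine sum_congr rfl fun j _ => ?_
  simp only [Option.some.injEq, ← Fin.lt_def]
  by_cases h : j < i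
  · have : i ≠ j := h.ne'
    by_cases h2 : p j = some i <;> simp [h, h2, this]
  · simp [h]

/-- Partial products. -/
def sig (a b : Fin n → Fin (n + 1)) (t : ℕ) : Equiv.Perm (Fin (n + 1)) :=
  ((List.ofFn (fun i => Equiv.swap (a i) (b i))).take t).reverse.prod

lemma sig_zero (a b : Fin n → Fin (n + 1)) : sig a b 0 = 1 := by simp [sig]

lemma sig_succ (a b : Fin n → Fin (n + 1)) (t : Fin n) :
    sig a b (t + 1) = Equiv.swap (a t) (b t) * sig a b t := by
  have ht : (t : ℕ) < (List.ofFn (fun i => Equiv.swap (a i) (b i))).length := by simp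
  rw [sig, List.take_add_one, List.getElem?_eq_getElem ht]
  simp [sig]

lemma sig_end (a b : Fin n → Fin (n + 1)) :
    sig a b n = (List.ofFn (fun i => Equiv.swap (a i) (b i))).reverse.prod := by
  rw [sig, List.take_of_length_le]
  simp

/-- The length of the arc. -/
def len (a b : Fin n → Fin (n + 1)) (i : Fin n) : ℤ := ((b i : ℕ) : ℤ) - ((a i : ℕ) : ℤ)

/-- Compatibility of arcs with a parent function. -/
structure Compat (a b : Fin n → Fin (n + 1)) (p : Fin n → Option (Fin n))
    (E : Option (Fin n) ≃ Fin (n + 1)) : Prop where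
  ab_lt : ∀ i, a i < b i
  E_none : E none = Fin.last n
  low : ∀ t : Fin n, ((E (some t) : ℕ) : ℤ) + shift p (len a b) (some t) t = ((a t : ℕ) : ℤ)
  high : ∀ t : Fin n, ((E (p t) : ℕ) : ℤ) + shift p (len a b) (p t) t = ((b t : ℕ) : ℤ)
  end_none : (n : ℤ) + shift p (len a b) none n = 0
  end_some : ∀ i, shift p (len a b) (some i) n = 1

lemma Compat.sig_eq {a b : Fin n → Fin (n + 1)} {p : Fin n → Option (Fin n)}
    {E : Option (Fin n) ≃ Fin (n + 1)} (C : Compat a b p E) (t : ℕ) (ht : t ≤ n)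
    (w : Option (Fin n)) :
    ((sig a b t (E w) : ℕ) : ℤ) = ((E w : ℕ) : ℤ) + shift p (len a b) w t := by
  induction t generalizing w with
  | zero => simp [sig_zero, shift_zero]
  | succ t ih =>
    have ih := ih (by omega)
    set T : Fin n := ⟨t, by omega⟩ with hT
    have h1 : sig a b (t + 1) = Equiv.swap (a T) (b T) * sig a b t := sig_succ a b T
    have h2 : shift p (len a b) w (t + 1) = shift p (len a b) w t +
      len a b T * ((if w = some T then 1 else 0) - (if p T = w then 1 else 0)) :=
      shift_succ p (len a b) w T
    have hlow : sig a b t (E (some T)) = a T := by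
      apply Fin.ext
      have := ih (some T)
      rw [show shift p (len a b) (some T) t = shift p (len a b) (some T) T from rfl, C.low] at this
      exact_mod_cast this
    have hhigh : sig a b t (E (p T)) = b T := by
      apply Fin.ext
      have := ih (p T)
      rw [show shift p (len a b) (p T) t = shift p (len a b) (p T) T from rfl, C.high] at this
      exact_mod_cast this
    have hab := C.ab_lt T
    have hne : p T ≠ some T := by
      intro h
      rw [h, hlow] at hhigh
      exact absurd hhigh hab.ne
    rw [h1, h2, Equiv.Perm.mul_apply, ← add_assoc, ← ih w]
    by_cases hw : w = some T
    · subst hw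
      rw [hlow, Equiv.swap_apply_left, if_pos rfl, if_neg hne, len]
      ring
    by_cases hw' : p T = w
    · subst hw'
      rw [hhigh, Equiv.swap_apply_right, if_neg hw, if_pos rfl, len]
      ring
    · rw [Equiv.swap_apply_of_ne_of_ne, if_neg hw, if_neg hw']
      · ring
      · rw [← hlow]
        intro h
        exact hw (E.injective ((sig a b t).injective h))
      · rw [← hhigh]
        intro h
        exact hw' (E.injective ((sig a b t).injective h)).symm

lemma Compat.prod_eq {a b : Fin n → Fin (n + 1)} {p : Fin n → Option (Fin n)}
    {E : Option (Fin n) ≃ Fin (n + 1)} (C : Compat a b p E) :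
    (List.ofFn (fun i => Equiv.swap (a i) (b i))).reverse.prod = finRotate (n + 1) := by
  rw [← sig_end]
  ext v
  obtain ⟨w, rfl⟩ := E.surjective v
  have h := C.sig_eq n le_rfl w
  cases w with
  | none =>
    rw [C.E_none] at h ⊢
    rw [Fin.val_last, C.end_none] at h
    rw [finRotate_last]
    simpa using h
  | some i =>
    have hne : E (some i) ≠ Fin.last n := by
      rw [← C.E_none]
      intro h
      have := E.injective h
      simp at this
    rw [coe_finRotate_of_ne_last hne]
    rw [C.end_some] at h
    exact_mod_cast h

lemma Compat.parent_unique {a b : Fin n → Fin (n + 1)} {p p' : Fin n → Option (Fin n)}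
    {E E' : Option (Fin n) ≃ Fin (n + 1)} (C : Compat a b p E) (C' : Compat a b p' E') :
    p = p' := by
  have key : ∀ (p : Fin n → Option (Fin n)) (E : Option (Fin n) ≃ Fin (n + 1)),
      Compat a b p E → ∀ t : Fin n, sig a b t (E (some t)) = a t ∧ sig a b t (E (p t)) = b t := by
    intro p E C t
    constructor
    · apply Fin.ext
      have := C.sig_eq t t.2.le (some t)
      rw [C.low] at this
      exact_mod_cast this
    · apply Fin.ext
      have := C.sig_eq t t.2.le (p t)
      rw [C.high] at this
      exact_mod_cast this
  have hE : ∀ w, E w = E' w := by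
    intro w
    cases w with
    | none => rw [C.E_none, C'.E_none]
    | some t =>
      apply (sig a b t).injective
      rw [(key p E C t).1, (key p' E' C' t).1]
  funext t
  apply E.injective
  apply (sig a b t).injective
  rw [(key p E C t).2, hE, (key p' E' C' t).2]

lemma Compat.len_eq {a b : Fin n → Fin (n + 1)} {F : RootedForest (Fin n)}
    {E : Option (Fin n) ≃ Fin (n + 1)} (C : Compat a b F.parent E) (i : Fin n) :
    len a b i = F.h i := by
  induction i using F.wf_child.induction with
  | _ i ih =>
    have h1 := C.end_some i
    rw [shift_some_end] at h1
    have h2 := F.sum_kids_some i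
    have h3 : ∑ j ∈ univ.filter (fun j => F.parent j = some i), len a b j
        = ∑ j ∈ univ.filter (fun j => F.parent j = some i), (F.h j : ℤ) :=
      sum_congr rfl fun j hj => ih j (by simpa using hj)
    rw [← h2]
    push_cast
    linarith

lemma Compat.arcs_unique {a b a' b' : Fin n → Fin (n + 1)} {F : RootedForest (Fin n)}
    {E E' : Option (Fin n) ≃ Fin (n + 1)} (C : Compat a b F.parent E)
    (C' : Compat a' b' F.parent E') : a = a' ∧ b = b' := by
  have hl : len a b = len a' b' := by
    funext i
    rw [C.len_eq, C'.len_eq]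
  have hE : ∀ i : Fin n, E (some i) = E' (some i) := by
    intro i
    induction i using F.wf_parent.induction with
    | _ i ih =>
      have hp : E (F.parent i) = E' (F.parent i) := by
        cases h : F.parent i with
        | none => rw [C.E_none, C'.E_none]
        | some j => exact ih j h
      have h1 := C.low i
      have h2 := C'.low i
      have h3 := C.high i
      have h4 := C'.high i
      have h5 := congrFun hl i
      simp only [hl] at h1 h3
      simp only [len] at h5
      rw [hp] at h3
      apply Fin.ext
      have : ((E (some i) : ℕ) : ℤ) = ((E' (some i) : ℕ) : ℤ) := by linarith
      exact_mod_cast this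
  have ha : a = a' := by
    funext i
    apply Fin.ext
    have h1 := C.low i
    have h2 := C'.low i
    rw [hl, hE, h2] at h1
    exact_mod_cast h1.symm
  refine ⟨ha, ?_⟩
  subst ha
  funext i
  have h5 := congrFun hl i
  simp only [len] at h5
  apply Fin.ext
  omega

lemma Compat.stats {f : MinFact n} {F : RootedForest (Fin n)}
    {E : Option (Fin n) ≃ Fin (n + 1)} (C : Compat f.a f.b F.parent E) :
    f.area = (F.maj : ℤ) ∧ f.coarea = (F.comaj : ℤ) ∧
      ∀ i : Fin n, (F.h i : ℤ) = ((f.b i : ℕ) : ℤ) - ((f.a i : ℕ) : ℤ) := by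
  have hh : ∀ i : Fin n, (F.h i : ℤ) = ((f.b i : ℕ) : ℤ) - ((f.a i : ℕ) : ℤ) :=
    fun i => (C.len_eq i).symm
  have hL : ∀ i, ((E (some i) : ℕ) : ℤ) = ((f.a i : ℕ) : ℤ) + (F.hL i : ℤ) := by
    intro i
    rw [← C.low i, shift_some_self, RootedForest.hL]
    push_cast
    have : ∀ j, len f.a f.b j = F.h j := C.len_eq
    simp [this]
  have hR : ∀ i, (F.hR i : ℤ) = ((f.b i : ℕ) : ℤ) - 1 - ((E (some i) : ℕ) : ℤ) := by
    intro i
    have h1 := F.hL_add_hR i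
    have h2 := hh i
    have h3 := hL i
    have h1' : (F.hL i : ℤ) + F.hR i + 1 = F.h i := by exact_mod_cast h1
    linarith
  have hs : ∑ i : Fin n, ((E (some i) : ℕ) : ℤ) = (n.choose 2 : ℤ) := by
    have h1 : ∑ w : Option (Fin n), (E w : ℕ) = ∑ v : Fin (n + 1), (v : ℕ) :=
      Equiv.sum_comp E (fun v => (v : ℕ))
    rw [Fintype.sum_option, C.E_none, Fin.val_last, Fin.sum_univ_castSucc] at h1
    simp only [Fin.val_last, Fin.val_castSucc] at h1
    have h2 : ∑ v : Fin n, (v : ℕ) = n.choose 2 := by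
      rw [Fin.sum_univ_eq_sum_range (fun i => i), sum_range_id, Nat.choose_two_right]
    have h3 : ∑ i : Fin n, (E (some i) : ℕ) = n.choose 2 := by omega
    exact_mod_cast h3
  refine ⟨?_, ?_, hh⟩
  · rw [MinFact.area, RootedForest.maj, ← hs]
    push_cast
    rw [← sum_sub_distrib]
    exact sum_congr rfl fun i _ => by rw [hL]; ring
  · rw [MinFact.coarea, RootedForest.comaj, ← hs]
    push_cast
    rw [← sum_sub_distrib]
    exact sum_congr rfl fun i _ => by rw [hR]

/-- Every factorization is compatible with some forest. -/
lemma exists_forest (f : MinFact n) :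
    ∃ (F : RootedForest (Fin n)) (E : Option (Fin n) ≃ Fin (n + 1)),
      Compat f.a f.b F.parent E := by
  classical
  set a := f.a with ha
  set b := f.b with hb
  let up : Fin n → Fin (n + 1) := fun t => (sig a b t).symm (a t)
  let down : Fin n → Fin (n + 1) := fun t => (sig a b t).symm (b t)
  have hup : ∀ t : Fin n, sig a b t (up t) = a t := fun t => Equiv.apply_symm_apply _ _
  have hdown : ∀ t : Fin n, sig a b t (down t) = b t := fun t => Equiv.apply_symm_apply _ _
  have step : ∀ (t : ℕ), t ≤ n → ∀ v, ((sig a b t v : ℕ) : ℤ) = ((v : ℕ) : ℤ) +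
      ∑ j : Fin n, if (j : ℕ) < t then
        len a b j * ((if v = up j then 1 else 0) - (if down j = v then 1 else 0)) else 0 := by
    intro t
    induction t with
    | zero => intro _ v; simp [sig_zero]
    | succ t ih =>
      intro ht v
      have ih := ih (by omega) v
      set T : Fin n := ⟨t, by omega⟩ with hT
      have h1 : sig a b (t + 1) = Equiv.swap (a T) (b T) * sig a b t := sig_succ a b T
      have h2 := sum_ite_succ (fun j => len a b j *
        ((if v = up j then 1 else 0) - (if down j = v then 1 else 0))) T
      have e : (T : ℕ) = t := rfl
      rw [e] at h2
      rw [h2, ← add_assoc, ← ih, h1, Equiv.Perm.mul_apply]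
      have hu : sig a b t (up T) = a T := hup T
      have hd : sig a b t (down T) = b T := hdown T
      have hab : a T < b T := f.ab_lt T
      by_cases hv : v = up T
      · have : down T ≠ v := by
          intro hdv
          rw [← hv, ← hdv, hd] at hu
          exact absurd hu.symm hab.ne
        rw [if_pos hv, if_neg this, hv, hu, Equiv.swap_apply_left, len]
        ring
      by_cases hv' : down T = v
      · rw [if_neg hv, if_pos hv', ← hv', hd, Equiv.swap_apply_right, len]
        ring
      · rw [Equiv.swap_apply_of_ne_of_ne, if_neg hv, if_neg hv']
        · ring
        · rw [← hu]
          intro h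
          exact hv ((sig a b t).injective h)
        · rw [← hd]
          intro h
          exact hv' ((sig a b t).injective h).symm
  have hlen : ∀ j, 0 < len a b j := by
    intro j
    have : a j < b j := f.ab_lt j
    rw [Fin.lt_def] at this
    simp only [len]
    omega
  have hend : ∀ v, sig a b n v = finRotate (n + 1) v := by
    intro v
    rw [sig_end, ha, hb, f.prod_eq]
  have hsurj : ∀ v : Fin (n + 1), v ≠ Fin.last n → ∃ t, up t = v := by
    intro v hv
    by_contra! hno
    have h1 := step n le_rfl v
    rw [hend, coe_finRotate_of_ne_last hv] at h1
    have h2 : (∑ j : Fin n, if (j : ℕ) < n then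
        len a b j * ((if v = up j then 1 else 0) - (if down j = v then 1 else 0)) else 0) ≤ 0 := by
      apply sum_nonpos
      intro j _
      rw [if_pos j.2, if_neg (hno j).symm]
      have := hlen j
      split_ifs <;> simp <;> linarith
    push_cast at h1
    linarith
  let E0 : Option (Fin n) → Fin (n + 1) := fun w => w.elim (Fin.last n) up
  have hE0 : Function.Bijective E0 := by
    rw [Fintype.bijective_iff_surjective_and_card]
    refine ⟨fun v => ?_, by simp⟩
    by_cases hv : v = Fin.last n
    · exact ⟨none, hv.symm⟩
    · obtain ⟨t, ht⟩ := hsurj v hv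
      exact ⟨some t, ht⟩
  let E : Option (Fin n) ≃ Fin (n + 1) := Equiv.ofBijective E0 hE0
  have hEn : E none = Fin.last n := rfl
  have hEs : ∀ t, E (some t) = up t := fun t => rfl
  let p : Fin n → Option (Fin n) := fun j => E.symm (down j)
  have hEp : ∀ t, E (p t) = down t := fun t => Equiv.apply_symm_apply _ _
  have step' : ∀ (t : ℕ), t ≤ n → ∀ w, ((sig a b t (E w) : ℕ) : ℤ)
      = ((E w : ℕ) : ℤ) + shift p (len a b) w t := by
    intro t ht w
    rw [step t ht, shift]
    congr 1
    refine sum_congr rfl fun j _ => ?_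
    simp only [← hEs, ← hEp, E.injective.eq_iff]
  have C : Compat a b p E := by
    refine ⟨f.ab_lt, hEn, ?_, ?_, ?_, ?_⟩
    · intro t
      rw [← step' t t.2.le, hEs, hup]
    · intro t
      rw [← step' t t.2.le, hEp, hdown]
    · have := step' n le_rfl none
      rw [hend, hEn, finRotate_last, Fin.val_last] at this
      rw [← this]; simp
    · intro i
      have := step' n le_rfl (some i)
      have hne : E (some i) ≠ Fin.last n := by
        rw [← hEn]
        intro h
        have := E.injective h
        simp at this
      rw [hend, coe_finRotate_of_ne_last hne] at this
      push_cast at this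
      linarith
  have hlt : ∀ i j, p i = some j → len a b i < len a b j := by
    intro i j hij
    have h1 := C.end_some j
    rw [shift_some_end] at h1
    have h2 : len a b i ≤ ∑ k ∈ univ.filter (fun k => p k = some j), len a b k :=
      single_le_sum (f := len a b) (fun k _ => (hlen k).le) (by simpa using hij)
    linarith
  refine ⟨⟨p, ?_⟩, E, C⟩
  have : ∀ u v, Relation.TransGen (fun x y : Fin n => p x = some y) u v →
      len a b u < len a b v := by
    intro u v h
    induction h with
    | single h => exact hlt _ _ h
    | tail _ h ih => exact ih.trans (hlt _ _ h)
  intro v hv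
  exact lt_irrefl _ (this v v hv)

lemma crossing (u : ℕ → ℤ) (v : ℤ) (s t : ℕ) (hst : s ≤ t) (hs : v < u s) (ht : u t ≤ v) :
    ∃ k, s ≤ k ∧ k < t ∧ v < u k ∧ u (k + 1) ≤ v := by
  induction t, hst using Nat.le_induction with
  | base => omega
  | succ t hst ih =>
    by_cases h : u t ≤ v
    · obtain ⟨k, h1, h2, h3⟩ := ih h
      exact ⟨k, h1, by omega, h3⟩
    · exact ⟨t, hst, by omega, by omega, ht⟩

/-- Every forest is compatible with some factorization. -/
lemma exists_fact (F : RootedForest (Fin n)) :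
    ∃ (f : MinFact n) (E : Option (Fin n) ≃ Fin (n + 1)), Compat f.a f.b F.parent E := by
  classical
  let p := F.parent
  let L : Fin n → ℤ := fun i => F.h i
  have hL : ∀ i, 0 < L i := fun i => by
    have := F.h_pos i
    simp only [L]
    exact_mod_cast this
  have sh_none : (n : ℤ) + shift p L none n = 0 := by
    rw [shift_none_end]
    have := F.sum_kids_none
    have : ∑ j ∈ univ.filter (fun j => F.parent j = none), (F.h j : ℤ) = n := by
      exact_mod_cast this
    simp only [p, L]
    linarith
  have sh_some : ∀ i, shift p L (some i) n = 1 := by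
    intro i
    rw [shift_some_end]
    have := F.sum_kids_some i
    have : ∑ j ∈ univ.filter (fun j => F.parent j = some i), (F.h j : ℤ) + 1 = F.h i := by
      exact_mod_cast this
    simp only [p, L]
    linarith
  have hpne : ∀ i, p i ≠ some i := fun i h => F.acyclic i (Relation.TransGen.single h)
  obtain ⟨s, hs0, hs⟩ : ∃ s : Option (Fin n) → ℤ, s none = n ∧
      ∀ j, s (some j) = s (p j) + shift p L (p j) j - L j - shift p L (some j) j := by
    let G : (j : Fin n) → ((i : Fin n) → F.parent j = some i → ℤ) → ℤ := fun j rec =>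
      (match h : F.parent j with
        | none => (n : ℤ)
        | some i => rec i h) + shift p L (p j) j - L j - shift p L (some j) j
    let s0 : Fin n → ℤ := F.wf_parent.fix G
    refine ⟨fun w => w.elim (n : ℤ) s0, rfl, ?_⟩
    intro j
    have h1 : s0 j = G j (fun i _ => s0 i) := WellFounded.fix_eq _ _ _
    have h2 : (match h : F.parent j with
        | none => (n : ℤ)
        | some i => s0 i) = (p j).elim (n : ℤ) s0 := by
      simp only [p]
      cases F.parent j <;> rfl
    change s0 j = _
    rw [h1]
    simp only [G]
    rw [h2]
  let A : Fin n → ℤ := fun i => s (some i) + shift p L (some i) i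
  let B : Fin n → ℤ := fun i => A i + L i
  have hB : ∀ i, B i = s (p i) + shift p L (p i) i := by
    intro i
    simp only [B, A]
    rw [hs i]
    ring
  -- a crossing comes from a child
  have cross : ∀ (w : Option (Fin n)) (v : ℤ) (t0 t1 : ℕ), t0 ≤ t1 → t1 ≤ n →
      v < s w + shift p L w t0 → s w + shift p L w t1 ≤ v →
      ∃ k : Fin n, p k = w ∧ A k ≤ v ∧ v < B k := by
    intro w v t0 t1 h01 h1n h0 h1
    obtain ⟨k, hk0, hk1, hk2, hk3⟩ := crossing (fun t => s w + shift p L w t) v t0 t1 h01 h0 h1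
    set K : Fin n := ⟨k, by omega⟩ with hK
    have h2 : shift p L w (k + 1) = shift p L w k +
      L K * ((if w = some K then 1 else 0) - (if p K = w then 1 else 0)) := shift_succ p L w K
    have hLK := hL K
    have hp : p K = w := by
      by_contra hne
      simp only [h2, if_neg hne] at hk2 hk3
      split_ifs at hk3 <;> simp at hk3 <;> linarith
    have hw : w ≠ some K := by
      rw [← hp]; exact hpne K
    simp only [h2, if_neg hw, if_pos hp] at hk3
    have hBK := hB K
    rw [hp] at hBK
    have e : (K : ℕ) = k := rfl
    rw [e] at hBK
    refine ⟨K, hp, ?_, ?_⟩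
    · have : A K = B K - L K := by simp only [B]; ring
      rw [this, hBK]
      linarith
    · rw [hBK]; exact hk2
  have cover : ∀ (i : Fin n) (v : ℤ), A i ≤ v → v < B i → ∃ k, s (some k) = v := by
    intro i
    induction i using F.wf_child.induction with
    | _ i ih =>
      intro v hA hB'
      rcases lt_trichotomy v (s (some i)) with h | h | h
      · obtain ⟨k, hk, hk1, hk2⟩ := cross (some i) v 0 i (Nat.zero_le _) i.2.le
          (by rw [shift_zero]; linarith) hA
        exact ih k hk v hk1 hk2
      · exact ⟨i, h.symm⟩
      · have h3 : s (some i) + shift p L (some i) (i + 1) = B i := by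
          rw [shift_succ, if_pos rfl, if_neg (hpne i)]
          simp only [B, A]
          ring
        obtain ⟨k, hk, hk1, hk2⟩ := cross (some i) v (i + 1) n i.2 le_rfl
          (by rw [h3]; exact hB') (by rw [sh_some]; linarith)
        exact ih k hk v hk1 hk2
  have cover' : ∀ v : ℤ, 0 ≤ v → v < n → ∃ k, s (some k) = v := by
    intro v h0 h1
    obtain ⟨k, -, hk1, hk2⟩ := cross none v 0 n (Nat.zero_le _) le_rfl
      (by rw [shift_zero, hs0]; linarith) (by rw [hs0, sh_none]; exact h0)
    exact cover k v hk1 hk2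
  have himg : Finset.Ico (0 : ℤ) n = univ.image (fun k : Fin n => s (some k)) := by
    apply Finset.eq_of_subset_of_card_le
    · intro v hv
      rw [Finset.mem_Ico] at hv
      obtain ⟨k, hk⟩ := cover' v hv.1 hv.2
      exact Finset.mem_image.2 ⟨k, Finset.mem_univ _, hk⟩
    · refine Finset.card_image_le.trans ?_
      simp
  have hsr : ∀ k : Fin n, 0 ≤ s (some k) ∧ s (some k) < n := by
    intro k
    have : s (some k) ∈ Finset.Ico (0 : ℤ) n := by
      rw [himg]
      exact Finset.mem_image.2 ⟨k, Finset.mem_univ _, rfl⟩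
    exact Finset.mem_Ico.1 this
  have hAB : ∀ i, A i < B i := by
    intro i
    have := hL i
    simp only [B]
    linarith
  have hA0 : ∀ i, 0 ≤ A i := by
    intro i
    obtain ⟨k, hk⟩ := cover i (A i) le_rfl (hAB i)
    rw [← hk]
    exact (hsr k).1
  have hBn : ∀ i, B i ≤ n := by
    intro i
    obtain ⟨k, hk⟩ := cover i (B i - 1) (by have := hAB i; omega) (by omega)
    have := (hsr k).2
    omega
  have hsw : ∀ w, 0 ≤ s w ∧ s w ≤ n := by
    intro w
    cases w with
    | none => rw [hs0]; omega
    | some k => exact ⟨(hsr k).1, (hsr k).2.le⟩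
  let E0 : Option (Fin n) → Fin (n + 1) := fun w => ⟨(s w).toNat, by have := hsw w; omega⟩
  have hE0v : ∀ w, ((E0 w : ℕ) : ℤ) = s w := fun w => Int.toNat_of_nonneg (hsw w).1
  have hE0 : Function.Bijective E0 := by
    rw [Fintype.bijective_iff_surjective_and_card]
    refine ⟨fun v => ?_, by simp⟩
    by_cases hv : (v : ℕ) = n
    · refine ⟨none, Fin.ext ?_⟩
      have := hE0v none
      rw [hs0] at this
      omega
    · obtain ⟨k, hk⟩ := cover' (v : ℕ) (by omega) (by have := v.2; omega)
      refine ⟨some k, Fin.ext ?_⟩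
      have := hE0v (some k)
      rw [hk] at this
      omega
  let E : Option (Fin n) ≃ Fin (n + 1) := Equiv.ofBijective E0 hE0
  have hEv : ∀ w, ((E w : ℕ) : ℤ) = s w := hE0v
  let a : Fin n → Fin (n + 1) := fun i =>
    ⟨(A i).toNat, by have := hA0 i; have := hAB i; have := hBn i; omega⟩
  let b : Fin n → Fin (n + 1) := fun i =>
    ⟨(B i).toNat, by have := hA0 i; have := hAB i; have := hBn i; omega⟩
  have hav : ∀ i, ((a i : ℕ) : ℤ) = A i := fun i => Int.toNat_of_nonneg (hA0 i)
  have hbv : ∀ i, ((b i : ℕ) : ℤ) = B i := fun i =>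
    Int.toNat_of_nonneg ((hA0 i).trans (hAB i).le)
  have hlen : len a b = L := by
    funext i
    rw [len, hav, hbv]
    simp only [B]
    ring
  have C : Compat a b F.parent E := by
    refine ⟨?_, ?_, ?_, ?_, ?_, ?_⟩
    · intro i
      rw [Fin.lt_def]
      have h1 := hav i
      have h2 := hbv i
      have h3 := hAB i
      omega
    · apply Fin.ext
      have := hEv none
      rw [hs0] at this
      rw [Fin.val_last]
      exact_mod_cast this
    · intro t
      rw [hlen, hEv, hav]
    · intro t
      rw [hlen, hEv, hbv, hB]
    · rw [hlen]; exact sh_none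
    · rw [hlen]; exact sh_some
  exact ⟨⟨a, b, C.ab_lt, C.prod_eq⟩, E, C⟩

end MinFactAux

/-- For every `n ≥ 1` there is a bijection `φ : F_n → R_n` such that,
with `F = φ f`: `area f = maj F`, `coarea f = comaj F`, and the hook length at vertex `i`
of `F` satisfies `h(i) = b_i - a_i` for every `i`. -/
theorem stmt7 (n : ℕ) (hn : 1 ≤ n) :
    ∃ φ : MinFact n ≃ RootedForest (Fin n),
      ∀ f : MinFact n,
        MinFact.area f = ((φ f).maj : ℤ) ∧
        MinFact.coarea f = ((φ f).comaj : ℤ) ∧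
        ∀ i : Fin n, ((φ f).h i : ℤ) = ((f.b i : ℕ) : ℤ) - ((f.a i : ℕ) : ℤ) := by
  classical
  choose φ E hφ using fun f : MinFact n => MinFactAux.exists_forest f
  have hb : Function.Bijective φ := by
    constructor
    · intro f g hfg
      have h1 := hφ f
      have h2 := hφ g
      rw [← hfg] at h2
      obtain ⟨h3, h4⟩ := h1.arcs_unique h2
      cases f
      cases g
      simp only at h3 h4
      subst h3 h4
      rfl
    · intro F
      obtain ⟨f, E', C⟩ := MinFactAux.exists_fact F
      refine ⟨f, ?_⟩
      have h := (hφ f).parent_unique C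
      generalize φ f = G at h
      cases G
      cases F
      simp only at h
      subst h
      rfl
  exact ⟨Equiv.ofBijective φ hb, fun f => (hφ f).stats⟩
end
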